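/- A cardinal κ is weakly shrewd if and only if for all cardinals θ > κ and all z ∈ H(θ), there exist cardinals κ̄ < θ̄, an elementary submodel X of H(θ̄), and an elementary embedding j : X → H(θ) such that κ̄ + 1 ⊆ X, j restricted to κ̄ is the identity, j(κ̄) = κ > κ̄, and z ∈ ran(j). -/

import Mathlib

universe u

open Cardinal

/-- Formulas of the language of set theory with an additional unary predicate
symbol `pred`; variables are indexed by natural numbers. -/
inductive SF : Type
  | mem : ℕ → ℕ → SF
  | eq : ℕ → ℕ → SF
  | pred : ℕ → SF
  | not : SF → SF
  | and : SF → SF → SF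
  | ex : ℕ → SF → SF

/-- The free variables of a formula. -/
def SF.fv : SF → Set ℕ
  | .mem i j => {i, j}
  | .eq i j => {i, j}
  | .pred i => {i}
  | .not φ => φ.fv
  | .and φ ψ => φ.fv ∪ ψ.fv
  | .ex k φ => φ.fv \ {k}

/-- Tarskian satisfaction of a formula in the structure whose carrier is the
class `S`, where the membership symbol is interpreted by the binary relation `E`
and the extra unary predicate symbol by the class `P`, under the valuation `v`. -/
def Sat (P : Set ZFSet.{u}) (E : ZFSet.{u} → ZFSet.{u} → Prop) (S : Set ZFSet.{u}) :
    SF → (ℕ → ZFSet.{u}) → Prop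
  | .mem i j, v => E (v i) (v j)
  | .eq i j, v => v i = v j
  | .pred i, v => v i ∈ P
  | .not φ, v => ¬ Sat P E S φ v
  | .and φ ψ, v => Sat P E S φ v ∧ Sat P E S ψ v
  | .ex k φ, v => ∃ x, x ∈ S ∧ Sat P E S φ (Function.update v k x)

/-- Satisfaction in the `∈`-structure with carrier `S`, the predicate symbol
being interpreted by the class `R`. -/
def SatIn (R : Set ZFSet.{u}) (S : Set ZFSet.{u}) (φ : SF) (v : ℕ → ZFSet.{u}) : Prop :=
  Sat R (· ∈ ·) S φ v

/-- Δ₀-formulas: built from atomic formulas by propositional connectives and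
bounded existential quantification. -/
inductive IsDeltaZero : SF → Prop
  | mem (i j) : IsDeltaZero (.mem i j)
  | eq (i j) : IsDeltaZero (.eq i j)
  | pred (i) : IsDeltaZero (.pred i)
  | not {φ} : IsDeltaZero φ → IsDeltaZero (.not φ)
  | and {φ ψ} : IsDeltaZero φ → IsDeltaZero ψ → IsDeltaZero (.and φ ψ)
  | bex {φ} (k j) : IsDeltaZero φ → IsDeltaZero (.ex k (.and (.mem k j) φ))

mutual
  /-- Σₙ-formulas of the Lévy hierarchy. -/
  inductive IsSigma : ℕ → SF → Prop
    | of_zero {φ} : IsDeltaZero φ → IsSigma 0 φ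
    | of_pi {n φ} : IsPi n φ → IsSigma (n + 1) φ
    | ex {n φ} (k) : IsSigma (n + 1) φ → IsSigma (n + 1) (.ex k φ)
  /-- Πₙ-formulas of the Lévy hierarchy. -/
  inductive IsPi : ℕ → SF → Prop
    | of_zero {φ} : IsDeltaZero φ → IsPi 0 φ
    | not {n φ} : IsSigma (n + 1) φ → IsPi (n + 1) (.not φ)
end

/-- The valuation sending `v₀` to `a`, `v₁` to `b` and all other variables to `∅`. -/
def val2 (a b : ZFSet.{u}) : ℕ → ZFSet.{u} := fun i => if i = 0 then a else if i = 1 then b else ∅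

/-- `x` is a (von Neumann) ordinal. -/
def ZOrd (x : ZFSet.{u}) : Prop := x.IsTransitive ∧ ∀ y ∈ x, ZFSet.IsTransitive y

/-- `κ` is a (von Neumann) cardinal. -/
def ZCard (κ : ZFSet.{u}) : Prop := ZOrd κ ∧ ∀ β ∈ κ, #β.toSet < #κ.toSet

/-- `κ` is an infinite cardinal. -/
def InfCard (κ : ZFSet.{u}) : Prop := ZCard κ ∧ ZFSet.omega ⊆ κ

/-- `κ` is an infinite regular cardinal: every cofinal subset of `κ` has
cardinality `κ`. -/
def ZRegular (κ : ZFSet.{u}) : Prop :=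
  InfCard κ ∧ ∀ x : ZFSet.{u}, x ⊆ κ →
    (∀ β ∈ κ, ∃ γ ∈ x, β ∈ γ ∨ β = γ) → #x.toSet = #κ.toSet

/-- `C` is a closed unbounded (class of) subset(s) of the ordinal `κ`. -/
def ZClub (C : Set ZFSet.{u}) (κ : ZFSet.{u}) : Prop :=
  (∀ γ ∈ C, γ ∈ κ) ∧ (∀ β ∈ κ, ∃ γ ∈ C, β ∈ γ) ∧
    (∀ β ∈ κ, (∃ γ, γ ∈ β) → (∀ γ ∈ β, ∃ δ ∈ C, γ ∈ δ ∧ δ ∈ β) → β ∈ C)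

/-- `S` is stationary in `κ`: it meets every closed unbounded subset of `κ`. -/
def ZStationary (S : Set ZFSet.{u}) (κ : ZFSet.{u}) : Prop :=
  ∀ C, ZClub C κ → ∃ γ ∈ C, γ ∈ S

/-- `H(θ)`: the class of all sets hereditarily of cardinality less than `θ`. -/
def HSet (θ : ZFSet.{u}) : Set ZFSet.{u} :=
  {x | ∃ t : ZFSet.{u}, t.IsTransitive ∧ x ⊆ t ∧ #t.toSet < #θ.toSet}

/-- `θ` is the cardinal successor `κ⁺` of `κ`. -/
def SuccCardOf (θ κ : ZFSet.{u}) : Prop :=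
  ZCard θ ∧ κ ∈ θ ∧ ∀ μ, ZCard μ → κ ∈ μ → θ ⊆ μ

/-- `κ` is a weakly shrewd cardinal. -/
def WeaklyShrewd (κ : ZFSet.{u}) : Prop :=
  InfCard κ ∧
    ∀ (φ : SF) (θ A : ZFSet.{u}), φ.fv ⊆ {0, 1} → ZCard θ → κ ∈ θ → A ⊆ κ →
      SatIn ∅ (HSet θ) φ (val2 A κ) →
      ∃ κ' θ' : ZFSet.{u}, ZCard κ' ∧ ZCard θ' ∧ κ' ∈ θ' ∧ κ' ∈ κ ∧
        SatIn ∅ (HSet θ') φ (val2 (A ∩ κ') κ')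

/-- `j` is an elementary embedding of the `∈`-structure (with predicate `R`)
with carrier `X` into the one with carrier `Y`. -/
def ElemEmbOn (R : Set ZFSet.{u}) (X Y : Set ZFSet.{u}) (j : ZFSet.{u} → ZFSet.{u}) : Prop :=
  (∀ x ∈ X, j x ∈ Y) ∧
    ∀ (φ : SF) (v : ℕ → ZFSet.{u}), (∀ i, v i ∈ X) →
      (SatIn R X φ v ↔ SatIn R Y φ (fun i => j (v i)))

/-- `X` is an elementary submodel of `Y` (as `∈`-structures with predicate `R`). -/
def ElemSub (R : Set ZFSet.{u}) (X Y : Set ZFSet.{u}) : Prop :=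
  X ⊆ Y ∧ ∀ (φ : SF) (v : ℕ → ZFSet.{u}), (∀ i, v i ∈ X) → (SatIn R X φ v ↔ SatIn R Y φ v)

/-- `X` is a Σₙ-elementary submodel of `Y`. -/
def SigmaElemSub (R : Set ZFSet.{u}) (n : ℕ) (X Y : Set ZFSet.{u}) : Prop :=
  X ⊆ Y ∧ ∀ (φ : SF), IsSigma n φ → ∀ (v : ℕ → ZFSet.{u}), (∀ i, v i ∈ X) →
    (SatIn R X φ v ↔ SatIn R Y φ v)


section basics

theorem card_lt_iff' (x y : ZFSet.{u}) : #x.toSet < #y.toSet ↔ x.card < y.card := by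
  have h : ∀ x : ZFSet.{u}, #x.toSet = lift.{u+1} x.card := fun x => ZFSet.cardinalMk_coe_sort
  rw [h, h, Cardinal.lift_lt]

theorem mem_HSet' {θ x : ZFSet.{u}} :
    x ∈ HSet θ ↔ ∃ t : ZFSet.{u}, t.IsTransitive ∧ x ⊆ t ∧ t.card < θ.card := by
  simp only [HSet, Set.mem_setOf_eq, card_lt_iff']

/-- transitive class -/
def STr (S : Set ZFSet.{u}) : Prop := ∀ x ∈ S, ∀ y ∈ x, y ∈ S

theorem STr_HSet (θ : ZFSet.{u}) : STr (HSet θ) := by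
  intro x hx y hy
  rw [mem_HSet'] at *
  obtain ⟨t, ht, hxt, hc⟩ := hx
  exact ⟨t, ht, ht _ (hxt hy), hc⟩

theorem HSet_subset {θ x y : ZFSet.{u}} (hx : x ∈ HSet θ) (hy : y ⊆ x) : y ∈ HSet θ := by
  rw [mem_HSet'] at *
  obtain ⟨t, ht, hxt, hc⟩ := hx
  exact ⟨t, ht, fun a ha => hxt (hy ha), hc⟩

theorem HSet_mono {θ θ' x : ZFSet.{u}} (h : θ.card ≤ θ'.card) (hx : x ∈ HSet θ) : x ∈ HSet θ' := by
  rw [mem_HSet'] at *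
  obtain ⟨t, ht, hxt, hc⟩ := hx
  exact ⟨t, ht, hxt, hc.trans_le h⟩

theorem card_lt_of_mem_HSet {θ x : ZFSet.{u}} (hx : x ∈ HSet θ) : x.card < θ.card := by
  rw [mem_HSet'] at *
  obtain ⟨t, ht, hxt, hc⟩ := hx
  exact (ZFSet.card_mono hxt).trans_lt hc

theorem mem_HSet_of_trans {θ x : ZFSet.{u}} (hx : x.IsTransitive) (hc : x.card < θ.card) :
    x ∈ HSet θ := mem_HSet'.2 ⟨x, hx, fun _ h => h, hc⟩

theorem card_range2_le (t : ZFSet.{u}) (f : t × t → ZFSet.{u}) :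
    (ZFSet.range f).card ≤ t.card * t.card := by
  have := ZFSet.lift_card_range_le (f := f)
  have h2 : #(t × t) = lift.{u+1} (t.card * t.card) := by
    rw [Cardinal.mk_prod, Cardinal.lift_mul, ZFSet.cardinalMk_coe_sort]; simp
  rw [h2] at this
  simpa [-Cardinal.lift_mul] using this

theorem HSet_prod {θ x y f : ZFSet.{u}} (hθ : ℵ₀ ≤ θ.card) (hx : x ∈ HSet θ) (hy : y ∈ HSet θ)
    (hf : f ⊆ ZFSet.prod x y) : f ∈ HSet θ := by
  refine HSet_subset ?_ hf
  rw [mem_HSet'] at *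
  obtain ⟨s, hs, hxs, hsc⟩ := hx
  obtain ⟨r, hr, hyr, hrc⟩ := hy
  set t := s ∪ r with ht
  have htt : t.IsTransitive := hs.union hr
  have htc : t.card < θ.card := (ZFSet.card_union_le).trans_lt (Cardinal.add_lt_of_lt hθ hsc hrc)
  have htc2 := Cardinal.mul_lt_of_lt hθ htc htc
  let U := ZFSet.range (fun q : t × t => ({q.1.1, q.2.1} : ZFSet.{u}))
  let W := ZFSet.range (fun q : t × t => ZFSet.pair q.1.1 q.2.1)
  refine ⟨(t ∪ U) ∪ W, ?_, ?_, ?_⟩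
  · intro a ha b hb
    simp only [ZFSet.mem_union] at ha ⊢
    rcases ha with (ha | ha) | ha
    · exact .inl (.inl (htt a ha hb))
    · obtain ⟨q, rfl⟩ := ZFSet.mem_range.1 ha
      rcases ZFSet.mem_pair.1 hb with rfl | rfl
      · exact .inl (.inl q.1.2)
      · exact .inl (.inl q.2.2)
    · obtain ⟨q, rfl⟩ := ZFSet.mem_range.1 ha
      rcases ZFSet.mem_pair.1 hb with rfl | rfl
      · exact .inl (.inr (ZFSet.mem_range.2 ⟨(q.1, q.1), by simp⟩))
      · exact .inl (.inr (ZFSet.mem_range.2 ⟨q, rfl⟩))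
  · intro q hq
    obtain ⟨a, ha, b, hb, rfl⟩ := ZFSet.mem_prod.1 hq
    refine ZFSet.mem_union.2 (.inr (ZFSet.mem_range.2 ⟨(⟨a, ?_⟩, ⟨b, ?_⟩), rfl⟩))
    · exact ZFSet.mem_union.2 (.inl (hxs ha))
    · exact ZFSet.mem_union.2 (.inr (hyr hb))
  · refine (ZFSet.card_union_le).trans_lt (Cardinal.add_lt_of_lt hθ
      ((ZFSet.card_union_le).trans_lt (Cardinal.add_lt_of_lt hθ htc ?_)) ?_)
    · exact (card_range2_le _ _).trans_lt htc2
    · exact (card_range2_le _ _).trans_lt htc2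

/-- `S` contains an injective multivalued relation from `x` into `y`. -/
def Inj (S : Set ZFSet.{u}) (x y : ZFSet.{u}) : Prop :=
  ∃ f ∈ S, (∀ a ∈ x, ∃ b ∈ y, ZFSet.pair a b ∈ f) ∧
    (∀ a ∈ x, ∀ a' ∈ x, ∀ b ∈ y, ZFSet.pair a b ∈ f → ZFSet.pair a' b ∈ f → a = a')

theorem card_le_iff_inj (x y : ZFSet.{u}) :
    x.card ≤ y.card ↔ ∃ f : x → y, Function.Injective f := by
  rw [← Cardinal.lift_le.{u+1}, ← ZFSet.cardinalMk_coe_sort, ← ZFSet.cardinalMk_coe_sort,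
    Cardinal.le_def]
  exact ⟨fun ⟨f⟩ => ⟨f, f.2⟩, fun ⟨f, h⟩ => ⟨⟨f, h⟩⟩⟩

theorem Inj_iff {θ x y : ZFSet.{u}} (hθ : ℵ₀ ≤ θ.card) (hx : x ∈ HSet θ) (hy : y ∈ HSet θ) :
    Inj (HSet θ) x y ↔ x.card ≤ y.card := by
  rw [card_le_iff_inj]
  constructor
  · rintro ⟨f, -, h1, h2⟩
    choose! g hg using h1
    refine ⟨fun a => ⟨g a.1, (hg a.1 a.2).1⟩, fun a a' h => ?_⟩
    have h' : g a.1 = g a'.1 := congrArg Subtype.val h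
    apply Subtype.ext
    refine h2 a.1 a.2 a'.1 a'.2 (g a.1) (hg _ a.2).1 (hg _ a.2).2 ?_
    rw [h']; exact (hg _ a'.2).2
  · rintro ⟨g, hg⟩
    refine ⟨ZFSet.sep (fun q => ∃ a : x, q = ZFSet.pair a.1 (g a).1) (ZFSet.prod x y),
      HSet_prod hθ hx hy ZFSet.sep_subset, ?_, ?_⟩
    · intro a ha
      refine ⟨(g ⟨a, ha⟩).1, (g ⟨a, ha⟩).2, ?_⟩
      rw [ZFSet.mem_sep, ZFSet.pair_mem_prod]
      exact ⟨⟨ha, (g ⟨a, ha⟩).2⟩, ⟨a, ha⟩, rfl⟩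
    · intro a ha a' ha' b hb h1 h2
      obtain ⟨-, c, hc⟩ := ZFSet.mem_sep.1 h1
      obtain ⟨-, d, hd⟩ := ZFSet.mem_sep.1 h2
      rw [ZFSet.pair_inj] at hc hd
      have : g c = g d := Subtype.ext (hc.2.symm.trans hd.2)
      rw [hc.1, hd.1, hg this]

theorem trans_rank {t : ZFSet.{u}} (ht : t.IsTransitive) :
    ∀ x : ZFSet.{u}, x ⊆ t → ∀ o < x.rank, ∃ y ∈ t, y.rank = o := by
  intro x
  induction x using ZFSet.inductionOn with
  | h x ih =>
    intro hx o ho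
    obtain ⟨y, hy, hoy⟩ := ZFSet.lt_rank_iff.1 ho
    rcases hoy.eq_or_lt with h | h
    · exact ⟨y, hx hy, h.symm⟩
    · exact ih y hy (ht _ (hx hy)) o h

theorem HSet_set (θ : ZFSet.{u}) : ∃ M : ZFSet.{u}, ∀ x, x ∈ M ↔ x ∈ HSet θ := by
  refine ⟨ZFSet.sep (· ∈ HSet θ) (ZFSet.vonNeumann (Order.succ θ.card.ord)), fun x => ?_⟩
  rw [ZFSet.mem_sep, and_iff_right_iff_imp]
  intro hx
  rw [mem_HSet'] at hx
  obtain ⟨t, ht, hxt, hc⟩ := hx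
  rw [ZFSet.mem_vonNeumann, Order.lt_succ_iff]
  refine (ZFSet.rank_mono hxt).trans ?_
  have h1 : t.rank.card ≤ t.card := by
    rw [← Ordinal.card_toZFSet, card_le_iff_inj]
    have : ∀ a : t.rank.toZFSet, ∃ y : t, y.1.rank.toZFSet = a.1 := by
      rintro ⟨a, ha⟩
      obtain ⟨o, ho, rfl⟩ := Ordinal.mem_toZFSet_iff.1 ha
      obtain ⟨y, hy, rfl⟩ := trans_rank ht t (fun _ h => h) o ho
      exact ⟨⟨y, hy⟩, rfl⟩
    choose f hf using this
    refine ⟨f, fun a b h => Subtype.ext ?_⟩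
    rw [← hf a, ← hf b, h]
  exact (Cardinal.lt_ord.2 (h1.trans_lt hc)).le

theorem ZOrd_iff (x : ZFSet.{u}) : ZOrd x ↔ x.IsOrdinal := by
  rw [ZFSet.isOrdinal_iff_forall_mem_isTransitive]; rfl

theorem ZCard_iff (x : ZFSet.{u}) : ZCard x ↔ x.IsOrdinal ∧ ∀ β ∈ x, β.card < x.card := by
  simp only [ZCard, ZOrd_iff, card_lt_iff']

theorem ZCard.exists_ord {x : ZFSet.{u}} (h : ZCard x) :
    ∃ k : Ordinal.{u}, x = k.toZFSet ∧ k.card.ord = k := by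
  rw [ZCard_iff] at h
  obtain ⟨k, rfl⟩ := ZFSet.isOrdinal_iff_mem_range_toZFSet.1 h.1
  refine ⟨k, rfl, le_antisymm (Cardinal.ord_card_le _) ?_⟩
  by_contra hlt
  rw [not_le] at hlt
  have := h.2 (k.card.ord.toZFSet) (Ordinal.toZFSet_mem_toZFSet_iff.2 hlt)
  simp [Ordinal.card_toZFSet] at this

theorem ZCard_ord (c : Cardinal.{u}) : ZCard c.ord.toZFSet := by
  rw [ZCard_iff]
  refine ⟨ZFSet.isOrdinal_toZFSet _, fun β hβ => ?_⟩
  obtain ⟨o, ho, rfl⟩ := Ordinal.mem_toZFSet_iff.1 hβ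
  simpa [Ordinal.card_toZFSet] using Cardinal.lt_ord.1 ho

/-- the von Neumann numerals -/
noncomputable def num (n : ℕ) : ZFSet.{u} := (n : Ordinal.{u}).toZFSet

theorem num_inj {m n : ℕ} : (num m : ZFSet.{u}) = num n ↔ m = n := by
  unfold num
  rw [Ordinal.toZFSet_injective.eq_iff]
  exact Nat.cast_inj

theorem num_zero : (num 0 : ZFSet.{u}) = ∅ := by simp [num]

theorem num_succ (n : ℕ) : (num (n+1) : ZFSet.{u}) = insert (num n) (num n) := by
  unfold num
  push_cast
  exact Ordinal.toZFSet_add_one _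

theorem num_mem_of_inductive {I : ZFSet.{u}} (h0 : ∅ ∈ I) (hs : ∀ i ∈ I, insert i i ∈ I) (n : ℕ) :
    num n ∈ I := by
  induction n with
  | zero => rw [num_zero]; exact h0
  | succ n ih => rw [num_succ]; exact hs _ ih

theorem InfCard.omega_le {x : ZFSet.{u}} {k : Ordinal.{u}} (h : InfCard x) (hk : x = k.toZFSet) :
    Ordinal.omega0 ≤ k := by
  rw [Ordinal.omega0_le]
  intro n
  have : num n ∈ x := h.2 (num_mem_of_inductive ZFSet.omega_zero (fun i hi => ZFSet.omega_succ hi) n)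
  rw [hk] at this
  exact (Ordinal.toZFSet_mem_toZFSet_iff.1 this).le

end basics

section pairing

/-- Goedel's well-ordering of pairs of ordinals. -/
def GO (x y : Ordinal.{u} × Ordinal.{u}) : Prop :=
  Prod.Lex (· < ·) (Prod.Lex (· < ·) (· < ·)) (max x.1 x.2, x.1, x.2) (max y.1 y.2, y.1, y.2)

theorem GO_wf : WellFounded (GO.{u}) :=
  InvImage.wf (fun x : Ordinal.{u} × Ordinal.{u} => (max x.1 x.2, x.1, x.2))
    (WellFounded.prod_lex Ordinal.lt_wf (WellFounded.prod_lex Ordinal.lt_wf Ordinal.lt_wf))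

theorem GO_def (x y : Ordinal.{u} × Ordinal.{u}) : GO x y ↔
    max x.1 x.2 < max y.1 y.2 ∨ (max x.1 x.2 = max y.1 y.2 ∧ (x.1 < y.1 ∨ x.1 = y.1 ∧ x.2 < y.2)) := by
  simp [GO, Prod.lex_def]

theorem GO_tri (x y : Ordinal.{u} × Ordinal.{u}) : GO x y ∨ x = y ∨ GO y x := by
  rw [GO_def, GO_def, Prod.ext_iff]
  rcases lt_trichotomy (max x.1 x.2) (max y.1 y.2) with h | h | h
  · simp [h]
  · rcases lt_trichotomy x.1 y.1 with h1 | h1 | h1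
    · simp [h, h1]
    · rcases lt_trichotomy x.2 y.2 with h2 | h2 | h2
      · exact .inl (.inr ⟨h, .inr ⟨h1, h2⟩⟩)
      · simp [h1, h2]
      · exact .inr (.inr (.inr ⟨h.symm, .inr ⟨h1.symm, h2⟩⟩))
    · simp [h, h1]
  · simp [h]

theorem GO_le {x y : Ordinal.{u} × Ordinal.{u}} (h : GO x y) :
    x.1 ≤ max y.1 y.2 ∧ x.2 ≤ max y.1 y.2 := by
  rw [GO_def] at h
  have : max x.1 x.2 ≤ max y.1 y.2 := by
    rcases h with h | h
    · exact h.le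
    · exact h.1.le
  exact ⟨(le_max_left _ _).trans this, (le_max_right _ _).trans this⟩

instance GO_small (y : Ordinal.{u} × Ordinal.{u}) : Small.{u} {x // GO x y} := by
  let f : {x // GO x y} → Set.Iic (max y.1 y.2) × Set.Iic (max y.1 y.2) :=
    fun x => (⟨x.1.1, (GO_le x.2).1⟩, ⟨x.1.2, (GO_le x.2).2⟩)
  have hf : Function.Injective f := by
    intro a b h
    simp only [f, Prod.mk.injEq] at h
    exact Subtype.ext (Prod.ext (congrArg Subtype.val h.1) (congrArg Subtype.val h.2))
  exact small_of_injective hf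

/-- Goedel pairing -/
noncomputable def gpair : Ordinal.{u} × Ordinal.{u} → Ordinal.{u} :=
  GO_wf.fix (fun y ih => ⨆ x : {x // GO x y}, Order.succ (ih x.1 x.2))

theorem gpair_eq (y : Ordinal.{u} × Ordinal.{u}) :
    gpair y = ⨆ x : {x // GO x y}, Order.succ (gpair x.1) := by
  rw [gpair, WellFounded.fix_eq]

theorem gpair_lt {x y : Ordinal.{u} × Ordinal.{u}} (h : GO x y) : gpair x < gpair y := by
  rw [gpair_eq y, ← Order.succ_le_iff]
  exact Ordinal.le_iSup (fun x : {x // GO x y} => Order.succ (gpair x.1)) ⟨x, h⟩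

theorem lt_gpair (y : Ordinal.{u} × Ordinal.{u}) :
    ∀ o, o < gpair y ↔ ∃ x, GO x y ∧ gpair x = o := by
  induction y using GO_wf.induction with
  | _ y ih =>
    intro o
    constructor
    · intro h
      rw [gpair_eq, Ordinal.lt_iSup_iff] at h
      obtain ⟨⟨x, hx⟩, h⟩ := h
      rw [Order.lt_succ_iff] at h
      rcases h.eq_or_lt with h | h
      · exact ⟨x, hx, h.symm⟩
      · obtain ⟨w, hw, e⟩ := (ih x hx o).1 h
        refine ⟨w, ?_, e⟩
        rcases GO_tri w y with h1 | h1 | h1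
        · exact h1
        · subst h1
          exact absurd (gpair_lt hx) (gpair_lt hw).not_gt
        · exact absurd ((gpair_lt h1).trans (gpair_lt hw)) (gpair_lt hx).not_gt
    · rintro ⟨x, hx, rfl⟩
      exact gpair_lt hx

theorem gpair_inj : Function.Injective (gpair.{u}) := by
  intro x y h
  rcases GO_tri x y with h1 | h1 | h1
  · exact absurd h (gpair_lt h1).ne
  · exact h1
  · exact absurd h (gpair_lt h1).ne'

/-- curried version -/
noncomputable def gp (a b : Ordinal.{u}) : Ordinal.{u} := gpair (a, b)

theorem snd_le_gp (a b : Ordinal.{u}) : b ≤ gp a b := by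
  have h0 : StrictMono (fun b : Ordinal.{u} => gp 0 b) := by
    intro b c h
    apply gpair_lt
    rw [GO_def]
    simp [h]
  refine (h0.le_apply (x := b)).trans ?_
  rcases eq_or_ne a 0 with rfl | ha
  · rfl
  · have ha := pos_iff_ne_zero.2 ha
    refine (gpair_lt ?_).le
    rw [GO_def]
    rcases lt_or_ge b a with h | h
    · left; simp [h, ha]
    · right; simp [h, ha]

theorem snd_lt_gp {a : Ordinal.{u}} (b : Ordinal.{u}) (ha : 0 < a) : b < gp a b := by
  refine (snd_le_gp 0 b).trans_lt (gpair_lt ?_)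
  rw [GO_def]
  rcases lt_or_ge b a with h | h
  · left; simp [h, ha]
  · right; simp [h, ha]

theorem fst_le_gp (a b : Ordinal.{u}) : a ≤ gp a b := by
  have h0 : StrictMono (fun a : Ordinal.{u} => gp a 0) := by
    intro b c h
    apply gpair_lt
    rw [GO_def]
    simp [h]
  refine (h0.le_apply (x := a)).trans ?_
  rcases eq_or_ne b 0 with rfl | hb
  · rfl
  · have hb := pos_iff_ne_zero.2 hb
    refine (gpair_lt ?_).le
    rw [GO_def]
    rcases lt_or_ge a b with h | h
    · left; simp [h]
    · right; simp [h, hb]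

/-- closure of an ordinal under pairing -/
def PClosed (k : Ordinal.{u}) : Prop := Ordinal.omega0 ≤ k ∧ ∀ a < k, ∀ b < k, gp a b < k

theorem PClosed_card {k : Ordinal.{u}} (h : k.card.ord = k) (hω : Ordinal.omega0 ≤ k) :
    PClosed k := by
  refine ⟨hω, fun a ha b hb => ?_⟩
  have hk : ℵ₀ ≤ k.card := by simpa using Ordinal.card_le_card hω
  set m := max a b with hm
  have hmk : m < k := max_lt ha hb
  rw [← h, Cardinal.lt_ord] at hmk
  have hmk' : (Order.succ m).card < k.card := by
    rw [Ordinal.card_succ]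
    exact Cardinal.add_lt_of_lt hk hmk (Cardinal.one_lt_aleph0.trans_le hk)
  rw [← h, Cardinal.lt_ord]
  have hc : (gp a b).card ≤ (Order.succ m).card * (Order.succ m).card := by
    rw [← Cardinal.lift_le.{u+1}, Cardinal.lift_mul, ← Cardinal.mk_Iio_ordinal,
      ← Cardinal.mk_Iio_ordinal, Cardinal.mul_def]
    have : ∀ o : Set.Iio (gp a b), ∃ x : Ordinal.{u} × Ordinal.{u}, GO x (a, b) ∧ gpair x = o.1 :=
      fun o => (lt_gpair (a, b) o.1).1 o.2
    choose f hf using this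
    refine Cardinal.mk_le_of_injective (f := fun o =>
      (⟨(f o).1, Order.lt_succ_iff.2 (GO_le (hf o).1).1⟩,
       ⟨(f o).2, Order.lt_succ_iff.2 (GO_le (hf o).1).2⟩)) ?_
    intro o o' h
    simp only [Prod.mk.injEq] at h
    have e : f o = f o' := Prod.ext (congrArg Subtype.val h.1) (congrArg Subtype.val h.2)
    apply Subtype.ext
    rw [← (hf o).2, ← (hf o').2, e]
  exact hc.trans_lt (Cardinal.mul_lt_of_lt hk hmk' hmk')

open Classical in
/-- decoding of pairs -/
noncomputable def unp (α : Ordinal.{u}) : Ordinal.{u} × Ordinal.{u} :=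
  if h : ∃ x, gpair x = α then h.choose else (0, 0)

theorem unp_gp (a b : Ordinal.{u}) : unp (gp a b) = (a, b) := by
  have h : ∃ x, gpair x = gp a b := ⟨(a, b), rfl⟩
  rw [unp, dif_pos h]
  exact gpair_inj h.choose_spec

theorem unp_snd_le (α : Ordinal.{u}) : (unp α).2 ≤ α := by
  by_cases h : ∃ x, gpair x = α
  · obtain ⟨⟨a, b⟩, rfl⟩ := h
    have := unp_gp a b
    unfold gp at this
    rw [this]; exact snd_le_gp a b
  · rw [unp, dif_neg h]; exact zero_le

theorem unp_fst_le (α : Ordinal.{u}) : (unp α).1 ≤ α := by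
  by_cases h : ∃ x, gpair x = α
  · obtain ⟨⟨a, b⟩, rfl⟩ := h
    have := unp_gp a b
    unfold gp at this
    rw [this]; exact fst_le_gp a b
  · rw [unp, dif_neg h]; exact zero_le

/-- decoding of finite sequences -/
noncomputable def dec : ℕ → Ordinal.{u} → Ordinal.{u}
  | 0, α => (unp α).1
  | i+1, α => dec i (unp α).2

theorem dec_le (i : ℕ) : ∀ α : Ordinal.{u}, dec i α ≤ α := by
  induction i with
  | zero => exact unp_fst_le
  | succ i ih => exact fun α => (ih _).trans (unp_snd_le α)

theorem PClosed.zero_lt {k : Ordinal.{u}} (hk : PClosed k) : 0 < k :=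
  Ordinal.omega0_pos.trans_le hk.1

theorem PClosed.code {k : Ordinal.{u}} (hk : PClosed k) (N : ℕ) :
    ∀ f : ℕ → Ordinal.{u}, (∀ i, f i < k) → ∃ α < k, ∀ i < N, dec i α = f i := by
  induction N with
  | zero => exact fun f _ => ⟨0, hk.zero_lt, fun i hi => absurd hi (Nat.not_lt_zero _)⟩
  | succ N ih =>
    intro f hf
    obtain ⟨α, hα, h⟩ := ih (fun i => f (i+1)) (fun i => hf _)
    refine ⟨gp (f 0) α, hk.2 _ (hf 0) _ hα, fun i hi => ?_⟩
    cases i with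
    | zero => simp [dec, unp_gp]
    | succ i => simp [dec, unp_gp, h i (by omega)]

end pairing

section logic

theorem sat_congr (P S : Set ZFSet.{u}) (φ : SF) :
    ∀ v w : ℕ → ZFSet.{u}, (∀ i ∈ φ.fv, v i = w i) → (SatIn P S φ v ↔ SatIn P S φ w) := by
  unfold SatIn
  induction φ with
  | mem i j =>
    intro v w h
    simp only [Sat]; rw [h i (by simp [SF.fv]), h j (by simp [SF.fv])]
  | eq i j =>
    intro v w h
    simp only [Sat]; rw [h i (by simp [SF.fv]), h j (by simp [SF.fv])]
  | pred i =>
    intro v w h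
    simp only [Sat]; rw [h i (by simp [SF.fv])]
  | not φ ih =>
    intro v w h
    simp only [Sat]; rw [ih v w h]
  | and φ ψ ih1 ih2 =>
    intro v w h
    simp only [Sat]
    rw [ih1 v w (fun i hi => h i (.inl hi)), ih2 v w (fun i hi => h i (.inr hi))]
  | ex k φ ih =>
    intro v w h
    simp only [Sat]
    refine exists_congr fun x => and_congr_right fun _ => ih _ _ fun i hi => ?_
    by_cases hik : i = k
    · subst hik; simp
    · simp [hik, h i ⟨hi, hik⟩]

theorem fv_bound (φ : SF) : ∃ N : ℕ, ∀ i ∈ φ.fv, i < N := by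
  induction φ with
  | mem i j => exact ⟨max i j + 1, by intro a ha; simp [SF.fv] at ha; omega⟩
  | eq i j => exact ⟨max i j + 1, by intro a ha; simp [SF.fv] at ha; omega⟩
  | pred i => exact ⟨i + 1, by intro a ha; simp [SF.fv] at ha; omega⟩
  | not φ ih => exact ih
  | and φ ψ ih1 ih2 =>
    obtain ⟨N, hN⟩ := ih1
    obtain ⟨M, hM⟩ := ih2
    refine ⟨max N M, fun i hi => ?_⟩
    rcases hi with hi | hi
    · exact lt_max_of_lt_left (hN i hi)
    · exact lt_max_of_lt_right (hM i hi)
  | ex k φ ih =>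
    obtain ⟨N, hN⟩ := ih
    exact ⟨N, fun i hi => hN i hi.1⟩

/-- Tarski-Vaught test -/
theorem tarski_vaught {P X M : Set ZFSet.{u}} (hXM : X ⊆ M)
    (h : ∀ (φ : SF) (k : ℕ) (v : ℕ → ZFSet.{u}), (∀ i, v i ∈ X) →
      (∃ x ∈ M, SatIn P M φ (Function.update v k x)) →
      ∃ x ∈ X, SatIn P M φ (Function.update v k x)) : ElemSub P X M := by
  refine ⟨hXM, fun φ => ?_⟩
  unfold SatIn at *
  induction φ with
  | mem i j => intro v hv; rfl
  | eq i j => intro v hv; rfl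
  | pred i => intro v hv; rfl
  | not φ ih => intro v hv; simp only [Sat]; rw [ih v hv]
  | and φ ψ ih1 ih2 => intro v hv; simp only [Sat]; rw [ih1 v hv, ih2 v hv]
  | ex k φ ih =>
    intro v hv
    simp only [Sat]
    have hu : ∀ x ∈ X, ∀ i, Function.update v k x i ∈ X := by
      intro x hx i
      by_cases hik : i = k
      · subst hik; simpa
      · simpa [hik] using hv i
    constructor
    · rintro ⟨x, hx, hs⟩
      exact ⟨x, hXM hx, (ih _ (hu x hx)).1 hs⟩
    · intro hs
      obtain ⟨x, hx, hs⟩ := h φ k v hv hs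
      exact ⟨x, hx, (ih _ (hu x hx)).2 hs⟩

theorem sat_iso {X Y : Set ZFSet.{u}} {j : ZFSet.{u} → ZFSet.{u}}
    (hj : ∀ x ∈ X, j x ∈ Y) (hs : ∀ y ∈ Y, ∃ x ∈ X, j x = y)
    (hi : ∀ x ∈ X, ∀ y ∈ X, j x = j y ↔ x = y) (hm : ∀ x ∈ X, ∀ y ∈ X, j x ∈ j y ↔ x ∈ y)
    (φ : SF) : ∀ v : ℕ → ZFSet.{u}, (∀ i, v i ∈ X) →
      (SatIn ∅ X φ v ↔ SatIn ∅ Y φ (fun i => j (v i))) := by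
  unfold SatIn
  induction φ with
  | mem i k => intro v hv; exact (hm _ (hv i) _ (hv k)).symm
  | eq i k => intro v hv; exact (hi _ (hv i) _ (hv k)).symm
  | pred i => intro v hv; simp [Sat]
  | not φ ih => intro v hv; simp only [Sat]; rw [ih v hv]
  | and φ ψ ih1 ih2 => intro v hv; simp only [Sat]; rw [ih1 v hv, ih2 v hv]
  | ex k φ ih =>
    intro v hv
    simp only [Sat]
    have hu : ∀ x ∈ X, ∀ i, Function.update v k x i ∈ X := by
      intro x hx i
      by_cases hik : i = k
      · subst hik; simpa
      · simpa [hik] using hv i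
    have he : ∀ x, (fun i => j (Function.update v k x i)) =
        Function.update (fun i => j (v i)) k (j x) := by
      intro x; funext i
      by_cases hik : i = k
      · subst hik; simp
      · simp [hik]
    constructor
    · rintro ⟨x, hx, h⟩
      refine ⟨j x, hj x hx, ?_⟩
      rw [← he]
      exact (ih _ (hu x hx)).1 h
    · rintro ⟨y, hy, h⟩
      obtain ⟨x, hx, rfl⟩ := hs y hy
      refine ⟨x, hx, (ih _ (hu x hx)).2 ?_⟩
      rw [he]; exact h

/-- elementary substructures of transitive classes are extensional -/
theorem elem_ext {X M : Set ZFSet.{u}} (hM : STr M) (h : ElemSub ∅ X M) {a b : ZFSet.{u}}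
    (ha : a ∈ X) (hb : b ∈ X) (hab : ∀ x ∈ X, x ∈ a ↔ x ∈ b) : a = b := by
  by_contra hne
  have key : ∀ a ∈ X, ∀ b ∈ X, (∀ x ∈ X, x ∈ a → x ∈ b) → ∀ x ∈ a, x ∈ b := by
    intro a ha b hb hab x hx
    by_contra hxb
    have := (h.2 (.ex 2 (.and (.mem 2 0) (.not (.mem 2 1)))) (fun i => if i = 0 then a else b)
      (fun i => by split_ifs <;> assumption)).2 (by
        refine ⟨x, hM a (h.1 ha) x hx, ?_, ?_⟩
        · simpa [Sat] using hx
        · simpa [Sat] using hxb)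
    obtain ⟨y, hy, h1, h2⟩ := this
    simp only [Sat] at h1 h2
    simp at h1 h2
    exact h2 (hab y hy h1)
  exact hne (ZFSet.ext fun x => ⟨key a ha b hb (fun x hx => (hab x hx).1) x,
    key b hb a ha (fun x hx => (hab x hx).2) x⟩)

/-- a coding of formulas by natural numbers -/
def SF.code : SF → ℕ
  | .mem i j => Nat.pair 0 (Nat.pair i j)
  | .eq i j => Nat.pair 1 (Nat.pair i j)
  | .pred i => Nat.pair 2 i
  | .not φ => Nat.pair 3 φ.code
  | .and φ ψ => Nat.pair 4 (Nat.pair φ.code ψ.code)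
  | .ex k φ => Nat.pair 5 (Nat.pair k φ.code)

theorem SF.code_inj : ∀ φ ψ : SF, φ.code = ψ.code → φ = ψ := by
  intro φ
  induction φ with
  | mem i j => intro ψ; cases ψ <;> simp [SF.code]
  | eq i j => intro ψ; cases ψ <;> simp [SF.code]
  | pred i => intro ψ; cases ψ <;> simp [SF.code]
  | not φ ih => intro ψ; cases ψ <;> simp [SF.code]; apply ih
  | and φ ψ ih1 ih2 =>
    intro ψ; cases ψ <;> simp [SF.code]; exact fun h1 h2 => ⟨ih1 _ h1, ih2 _ h2⟩
  | ex k φ ih => intro ψ; cases ψ <;> simp [SF.code]; exact fun h1 h2 => ⟨h1, ih _ h2⟩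

theorem exists_enum : ∃ e : ℕ → SF × ℕ, Function.Surjective e := by
  have : Countable SF := Function.Injective.countable (f := SF.code) (fun a b h => SF.code_inj a b h)
  haveI : Nonempty (SF × ℕ) := ⟨(.eq 0 0, 0)⟩
  exact exists_surjective_nat _

/-- fixed enumeration -/
noncomputable def enumSF : ℕ → SF × ℕ := exists_enum.choose
theorem enumSF_surj : Function.Surjective enumSF := exists_enum.choose_spec

open Classical in
/-- Skolem functions -/
noncomputable def skol (M : Set ZFSet.{u}) (q : SF × ℕ) (v : ℕ → ZFSet.{u}) : ZFSet.{u} :=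
  if h : ∃ x ∈ M, SatIn ∅ M q.1 (Function.update v q.2 x) then h.choose else ∅

theorem skol_mem {M : Set ZFSet.{u}} (h0 : ∅ ∈ M) (q : SF × ℕ) (v : ℕ → ZFSet.{u}) :
    skol M q v ∈ M := by
  unfold skol; split_ifs with h
  · exact h.choose_spec.1
  · exact h0

theorem skol_spec {M : Set ZFSet.{u}} (q : SF × ℕ) (v : ℕ → ZFSet.{u})
    (h : ∃ x ∈ M, SatIn ∅ M q.1 (Function.update v q.2 x)) :
    SatIn ∅ M q.1 (Function.update v q.2 (skol M q v)) := by
  unfold skol; rw [dif_pos h]; exact h.choose_spec.2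

open Classical in
/-- enumeration of the Skolem hull of `κ ∪ {κ, z}` in `M` -/
noncomputable def hull (κ z : ZFSet.{u}) (M : Set ZFSet.{u}) : Ordinal.{u} → ZFSet.{u} :=
  Ordinal.lt_wf.fix fun α ih =>
    if gpair (unp α) = α then
      if (unp α).1 = 0 then (unp α).2.toZFSet
      else if (unp α).1 = 1 then (if (unp α).2 = 0 then κ else z)
      else if h : ∃ n : ℕ, (unp α).1 = (n : Ordinal.{u}) + 2 then
        skol M (enumSF h.choose)
          (fun i => if hi : dec i (unp α).2 < α then ih _ hi else ∅)
      else ∅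
    else ∅

open Classical in
theorem hull_eq (κ z : ZFSet.{u}) (M : Set ZFSet.{u}) (α : Ordinal.{u}) : hull κ z M α =
    if gpair (unp α) = α then
      if (unp α).1 = 0 then (unp α).2.toZFSet
      else if (unp α).1 = 1 then (if (unp α).2 = 0 then κ else z)
      else if h : ∃ n : ℕ, (unp α).1 = (n : Ordinal.{u}) + 2 then
        skol M (enumSF h.choose)
          (fun i => if _hi : dec i (unp α).2 < α then hull κ z M (dec i (unp α).2) else ∅)
      else ∅
    else ∅ := by
  rw [hull, WellFounded.fix_eq]

theorem hull_zero (κ z : ZFSet.{u}) (M : Set ZFSet.{u}) (β : Ordinal.{u}) :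
    hull κ z M (gp 0 β) = β.toZFSet := by
  rw [hull_eq, unp_gp]; simp [gp]

theorem hull_one (κ z : ZFSet.{u}) (M : Set ZFSet.{u}) :
    hull κ z M (gp 1 0) = κ := by
  rw [hull_eq, unp_gp]; simp [gp]

theorem hull_one_one (κ z : ZFSet.{u}) (M : Set ZFSet.{u}) :
    hull κ z M (gp 1 1) = z := by
  rw [hull_eq, unp_gp]; simp [gp]

theorem hull_skol (κ z : ZFSet.{u}) (M : Set ZFSet.{u}) (n : ℕ) (β : Ordinal.{u}) :
    hull κ z M (gp (n+2) β) = skol M (enumSF n) (fun i => hull κ z M (dec i β)) := by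
  rw [hull_eq, unp_gp]
  have h2 : (n : Ordinal.{u}) + 2 = ((n + 2 : ℕ) : Ordinal.{u}) := by push_cast; rfl
  have h : ∃ m : ℕ, (n : Ordinal.{u}) + 2 = (m : Ordinal.{u}) + 2 := ⟨n, rfl⟩
  have hm : h.choose = n := by
    have := h.choose_spec
    have h3 : ((n + 2 : ℕ) : Ordinal.{u}) = ((h.choose + 2 : ℕ) : Ordinal.{u}) := by
      push_cast; exact this
    have := Nat.cast_inj.1 h3
    omega
  have hne0 : (n : Ordinal.{u}) + 2 ≠ 0 := by
    rw [h2]; exact_mod_cast (by omega : n + 2 ≠ 0)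
  have hne1 : (n : Ordinal.{u}) + 2 ≠ 1 := by
    rw [h2]; exact_mod_cast (by omega : n + 2 ≠ 1)
  have hlt : ∀ i, dec i β < gp (n+2) β := fun i =>
    (dec_le i β).trans_lt (snd_lt_gp β (pos_iff_ne_zero.2 hne0))
  rw [if_pos (by rfl), if_neg hne0, if_neg hne1, dif_pos h, hm]
  simp only [hlt, dite_true]

theorem hull_mem {κ z : ZFSet.{u}} {M : Set ZFSet.{u}} (h0 : ∅ ∈ M) (hκ : κ ∈ M) (hz : z ∈ M)
    {k : Ordinal.{u}} (hk : ∀ α < k, α.toZFSet ∈ M) (α : Ordinal.{u}) (hα : α < k) :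
    hull κ z M α ∈ M := by
  rw [hull_eq]
  split_ifs
  · exact hk _ ((unp_snd_le α).trans_lt hα)
  · exact hκ
  · exact hz
  · exact skol_mem h0 _ _
  · exact h0
  · exact h0

theorem hull_elem {κ z : ZFSet.{u}} {M : Set ZFSet.{u}} {k : Ordinal.{u}} (hk : PClosed k)
    (hM : ∀ α < k, hull κ z M α ∈ M) :
    ElemSub ∅ {x | ∃ α < k, hull κ z M α = x} M := by
  apply tarski_vaught
  · rintro x ⟨α, hα, rfl⟩; exact hM α hα
  intro φ m v hv hx
  choose f hf using hv
  obtain ⟨N, hN⟩ := fv_bound φ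
  obtain ⟨α, hα, hd⟩ := hk.code N f (fun i => (hf i).1)
  obtain ⟨n, hn⟩ := enumSF_surj (φ, m)
  have hc : ∀ x, SatIn ∅ M φ (Function.update v m x) ↔
      SatIn ∅ M φ (Function.update (fun i => hull κ z M (dec i α)) m x) := by
    intro x
    apply sat_congr
    intro i hi
    by_cases him : i = m
    · subst him; simp
    · simp only [Function.update_of_ne him]
      rw [hd i (hN i hi), (hf i).2]
  refine ⟨hull κ z M (gp (n+2) α), ⟨gp (n+2) α, hk.2 _ ?_ _ hα, rfl⟩, ?_⟩
  · have : ((n + 2 : ℕ) : Ordinal.{u}) < k := (Ordinal.nat_lt_omega0 _).trans_le hk.1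
    exact_mod_cast this
  · rw [hc, hull_skol, hn]
    apply skol_spec (φ, m)
    obtain ⟨x, hx, hs⟩ := hx
    exact ⟨x, hx, (hc x).1 hs⟩

end logic

section definability

/-- extension of a finite assignment -/
def extv {n : ℕ} (v : Fin n → ZFSet.{u}) : ℕ → ZFSet.{u} :=
  fun i => if h : i < n then v ⟨i, h⟩ else ∅

/-- uniform definability of a predicate over all transitive classes -/
def DD (n : ℕ) (P : Set ZFSet.{u} → (Fin n → ZFSet.{u}) → Prop) : Prop :=
  ∃ φ : SF, (∀ i ∈ φ.fv, i < n) ∧ ∀ S : Set ZFSet.{u}, STr S → ∀ v : Fin n → ZFSet.{u},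
    (∀ i, v i ∈ S) → (SatIn ∅ S φ (extv v) ↔ P S v)

variable {n : ℕ}

theorem extv_fin (v : Fin n → ZFSet.{u}) (i : Fin n) : extv v i = v i := by simp [extv]

theorem extv_snoc (v : Fin n → ZFSet.{u}) (x : ZFSet.{u}) :
    Function.update (extv v) n x = extv (Fin.snoc (α := fun _ => ZFSet.{u}) v x) := by
  funext i
  by_cases h : i = n
  · subst h
    simp [extv, Fin.snoc]
  · rw [Function.update_of_ne h]
    by_cases h' : i < n
    · simp [extv, Fin.snoc, h', Nat.lt_succ_of_lt h']
    · have : ¬ i < n + 1 := by omega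
      simp [extv, h', this]

theorem DD.mem (i j : Fin n) : DD n (fun (_ : Set ZFSet.{u}) v => v i ∈ v j) := by
  refine ⟨.mem i j, ?_, ?_⟩
  · intro a ha
    simp only [SF.fv, Set.mem_insert_iff, Set.mem_singleton_iff] at ha
    rcases ha with rfl | rfl
    · exact i.2
    · exact j.2
  · intro S _ v _
    simp only [SatIn, Sat, extv_fin]

theorem DD.eq (i j : Fin n) : DD n (fun (_ : Set ZFSet.{u}) v => v i = v j) := by
  refine ⟨.eq i j, ?_, ?_⟩
  · intro a ha
    simp only [SF.fv, Set.mem_insert_iff, Set.mem_singleton_iff] at ha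
    rcases ha with rfl | rfl
    · exact i.2
    · exact j.2
  · intro S _ v _
    simp only [SatIn, Sat, extv_fin]

theorem DD.not {P : Set ZFSet.{u} → (Fin n → ZFSet.{u}) → Prop} (h : DD n P) :
    DD n (fun S v => ¬ P S v) := by
  obtain ⟨φ, hφ, h⟩ := h
  refine ⟨.not φ, hφ, fun S hS v hv => ?_⟩
  show _ ↔ ¬ P S v
  rw [← h S hS v hv]; rfl

theorem DD.and {P Q : Set ZFSet.{u} → (Fin n → ZFSet.{u}) → Prop} (h : DD n P) (h' : DD n Q) :
    DD n (fun S v => P S v ∧ Q S v) := by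
  obtain ⟨φ, hφ, h⟩ := h
  obtain ⟨ψ, hψ, h'⟩ := h'
  refine ⟨.and φ ψ, ?_, fun S hS v hv => ?_⟩
  · rintro i (hi | hi)
    · exact hφ i hi
    · exact hψ i hi
  · show _ ↔ (P S v ∧ Q S v)
    rw [← h S hS v hv, ← h' S hS v hv]; rfl

theorem DD.congr {P Q : Set ZFSet.{u} → (Fin n → ZFSet.{u}) → Prop} (h : DD n P)
    (hc : ∀ S, STr S → ∀ v, (∀ i, v i ∈ S) → (P S v ↔ Q S v)) : DD n Q := by
  obtain ⟨φ, hφ, h⟩ := h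
  exact ⟨φ, hφ, fun S hS v hv => (h S hS v hv).trans (hc S hS v hv)⟩

theorem DD.or {P Q : Set ZFSet.{u} → (Fin n → ZFSet.{u}) → Prop} (h : DD n P) (h' : DD n Q) :
    DD n (fun S v => P S v ∨ Q S v) :=
  (DD.not (DD.and (DD.not h) (DD.not h'))).congr (fun S _ v _ => by tauto)

theorem DD.imp {P Q : Set ZFSet.{u} → (Fin n → ZFSet.{u}) → Prop} (h : DD n P) (h' : DD n Q) :
    DD n (fun S v => P S v → Q S v) :=
  (DD.not (DD.and h (DD.not h'))).congr (fun S _ v _ => by tauto)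

theorem DD.iff {P Q : Set ZFSet.{u} → (Fin n → ZFSet.{u}) → Prop} (h : DD n P) (h' : DD n Q) :
    DD n (fun S v => P S v ↔ Q S v) :=
  (DD.and (DD.imp h h') (DD.imp h' h)).congr (fun S _ v _ => by tauto)

theorem DD.exS {P : Set ZFSet.{u} → (Fin n → ZFSet.{u}) → ZFSet.{u} → Prop}
    (h : DD (n+1) (fun S w => P S (fun i => w i.castSucc) (w (Fin.last n)))) :
    DD n (fun S v => ∃ x ∈ S, P S v x) := by
  obtain ⟨φ, hφ, h⟩ := h
  refine ⟨.ex n φ, ?_, fun S hS v hv => ?_⟩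
  · rintro i ⟨hi, hin⟩
    have := hφ i hi
    have : i ≠ n := hin
    omega
  · simp only [SatIn, Sat]
    refine exists_congr fun x => and_congr_right fun hx => ?_
    rw [extv_snoc]
    have := h S hS (Fin.snoc (α := fun _ => ZFSet.{u}) v x) (by
      intro i
      refine Fin.lastCases ?_ (fun j => ?_) i
      · simpa using hx
      · simpa using hv j)
    simp only [Fin.snoc_castSucc, Fin.snoc_last] at this
    exact this

theorem DD.allS {P : Set ZFSet.{u} → (Fin n → ZFSet.{u}) → ZFSet.{u} → Prop}
    (h : DD (n+1) (fun S w => P S (fun i => w i.castSucc) (w (Fin.last n)))) :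
    DD n (fun S v => ∀ x ∈ S, P S v x) :=
  (DD.not (DD.exS (P := fun S v x => ¬ P S v x) (DD.not h))).congr (fun S _ v _ => by
    push Not; rfl)

theorem DD.bex {P : Set ZFSet.{u} → (Fin n → ZFSet.{u}) → ZFSet.{u} → Prop} (j : Fin n)
    (h : DD (n+1) (fun S w => P S (fun i => w i.castSucc) (w (Fin.last n)))) :
    DD n (fun S v => ∃ x ∈ v j, P S v x) :=
  (DD.exS (P := fun S v x => x ∈ v j ∧ P S v x) (DD.and (DD.mem _ _) h)).congr
    (fun S hS v hv => ⟨fun ⟨x, _, h⟩ => ⟨x, h⟩, fun ⟨x, h⟩ => ⟨x, hS _ (hv j) x h.1, h⟩⟩)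

theorem DD.ball {P : Set ZFSet.{u} → (Fin n → ZFSet.{u}) → ZFSet.{u} → Prop} (j : Fin n)
    (h : DD (n+1) (fun S w => P S (fun i => w i.castSucc) (w (Fin.last n)))) :
    DD n (fun S v => ∀ x ∈ v j, P S v x) :=
  (DD.not (DD.bex (P := fun S v x => ¬ P S v x) j (DD.not h))).congr (fun S _ v _ => by
    push Not; rfl)

/-- `q = {x, y}` -/
def cUP (q x y : ZFSet.{u}) : Prop := x ∈ q ∧ y ∈ q ∧ ∀ w ∈ q, w = x ∨ w = y

theorem cUP_iff (q x y : ZFSet.{u}) : cUP q x y ↔ q = {x, y} := by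
  constructor
  · rintro ⟨h1, h2, h3⟩
    ext w
    rw [ZFSet.mem_pair]
    refine ⟨h3 w, ?_⟩
    rintro (rfl | rfl) <;> assumption
  · rintro rfl
    refine ⟨by simp, by simp, fun w hw => ZFSet.mem_pair.1 hw⟩

theorem DD.cUP (i j k : Fin n) : DD n (fun (_ : Set ZFSet.{u}) v => cUP (v i) (v j) (v k)) := by
  unfold _root_.cUP
  repeat' first
    | apply DD.iff
    | apply DD.not
    | apply DD.exS
    | apply DD.allS
    | apply DD.bex
    | apply DD.ball
    | apply DD.and
    | apply DD.or
    | apply DD.imp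
    | apply DD.eq
    | apply DD.mem

/-- `q` is the pair of `x, y` -/
def cOP (q x y : ZFSet.{u}) : Prop :=
  ∃ s ∈ q, ∃ t ∈ q, cUP s x x ∧ cUP t x y ∧ cUP q s t

theorem cOP_iff (q x y : ZFSet.{u}) : cOP q x y ↔ q = ZFSet.pair x y := by
  simp only [cOP, cUP_iff]
  constructor
  · rintro ⟨s, -, t, -, rfl, rfl, rfl⟩
    simp [ZFSet.pair]
  · rintro rfl
    exact ⟨{x}, by simp [ZFSet.pair], {x, y}, by simp [ZFSet.pair], by simp, rfl, rfl⟩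

theorem DD.cOP (i j k : Fin n) :
    DD n (fun (_ : Set ZFSet.{u}) v => v i = ZFSet.pair (v j) (v k)) := by
  refine DD.congr (P := fun _ v => _root_.cOP (v i) (v j) (v k)) ?_ (fun _ _ _ _ => cOP_iff _ _ _)
  unfold _root_.cOP
  repeat' first
    | apply DD.cUP
    | apply DD.iff
    | apply DD.not
    | apply DD.exS
    | apply DD.allS
    | apply DD.bex
    | apply DD.ball
    | apply DD.and
    | apply DD.or
    | apply DD.imp
    | apply DD.eq
    | apply DD.mem

theorem DD.pm (i j k : Fin n) :
    DD n (fun (_ : Set ZFSet.{u}) v => ZFSet.pair (v i) (v j) ∈ v k) := by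
  refine DD.congr (P := fun _ v => ∃ q ∈ v k, q = ZFSet.pair (v i) (v j)) ?_
    (fun _ _ _ _ => ⟨fun ⟨q, h, e⟩ => e ▸ h, fun h => ⟨_, h, rfl⟩⟩)
  repeat' first
    | apply DD.cOP
    | apply DD.iff
    | apply DD.not
    | apply DD.exS
    | apply DD.allS
    | apply DD.bex
    | apply DD.ball
    | apply DD.and
    | apply DD.or
    | apply DD.imp
    | apply DD.eq
    | apply DD.mem

/-- value of a binary function coded by a set -/
def P3 (p α β γ : ZFSet.{u}) : Prop := ZFSet.pair (ZFSet.pair α β) γ ∈ p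

theorem DD.P3 (p i j k : Fin n) :
    DD n (fun (_ : Set ZFSet.{u}) v => P3 (v p) (v i) (v j) (v k)) := by
  refine DD.congr (P := fun _ v => ∃ q ∈ v p, ∃ d ∈ q, ∃ r ∈ d, r = ZFSet.pair (v i) (v j) ∧
      q = ZFSet.pair r (v k)) ?_ (fun _ _ v _ => ?_)
  · repeat' first
      | apply DD.cOP
      | apply DD.bex
      | apply DD.and
  · constructor
    · rintro ⟨q, hq, d, hd, r, hr, rfl, rfl⟩; exact hq
    · intro h
      exact ⟨_, h, {ZFSet.pair (v i) (v j)}, by simp [ZFSet.pair], ZFSet.pair (v i) (v j), by simp,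
        rfl, rfl⟩

/-- Goedel ordering, first-order version -/
def cGO (a' b' a b : ZFSet.{u}) : Prop :=
  ((a' ∈ a ∨ a' ∈ b) ∧ (b' ∈ a ∨ b' ∈ b)) ∨
    (¬ ((a ∈ a' ∨ a ∈ b') ∧ (b ∈ a' ∨ b ∈ b')) ∧ (a' ∈ a ∨ (a' = a ∧ b' ∈ b)))

theorem DD.cGO (i j k l : Fin n) :
    DD n (fun (_ : Set ZFSet.{u}) v => cGO (v i) (v j) (v k) (v l)) := by
  unfold _root_.cGO
  repeat' first
    | apply DD.iff
    | apply DD.not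
    | apply DD.exS
    | apply DD.allS
    | apply DD.bex
    | apply DD.ball
    | apply DD.and
    | apply DD.or
    | apply DD.imp
    | apply DD.eq
    | apply DD.mem

theorem cGO_iff (a' b' a b : Ordinal.{u}) :
    cGO a'.toZFSet b'.toZFSet a.toZFSet b.toZFSet ↔ GO (a', b') (a, b) := by
  rw [GO_def]
  simp only [cGO, Ordinal.toZFSet_mem_toZFSet_iff, Ordinal.toZFSet_injective.eq_iff,
    ← lt_max_iff, ← max_lt_iff, not_lt]
  constructor
  · rintro (h | ⟨h1, h2⟩)
    · exact .inl h
    · rcases h1.lt_or_eq with h | h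
      · exact .inl h
      · exact .inr ⟨h, h2⟩
  · rintro (h | ⟨h1, h2⟩)
    · exact .inl h
    · exact .inr ⟨h1.le, h2⟩

theorem DD.Inj (i j : Fin n) : DD n (fun S v => Inj.{u} S (v i) (v j)) := by
  unfold _root_.Inj
  repeat' first
    | apply DD.pm
    | apply DD.iff
    | apply DD.not
    | apply DD.exS
    | apply DD.allS
    | apply DD.bex
    | apply DD.ball
    | apply DD.and
    | apply DD.or
    | apply DD.imp
    | apply DD.eq
    | apply DD.mem

/-- transitive set -/
def cTr (x : ZFSet.{u}) : Prop := ∀ y ∈ x, ∀ w ∈ y, w ∈ x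

theorem DD.cTr (i : Fin n) : DD n (fun (_ : Set ZFSet.{u}) v => cTr (v i)) := by
  unfold _root_.cTr
  repeat' first
    | apply DD.iff
    | apply DD.not
    | apply DD.exS
    | apply DD.allS
    | apply DD.bex
    | apply DD.ball
    | apply DD.and
    | apply DD.or
    | apply DD.imp
    | apply DD.eq
    | apply DD.mem

/-- cardinal, relative to `S` -/
def cCard (S : Set ZFSet.{u}) (θ : ZFSet.{u}) : Prop :=
  cTr θ ∧ (∀ y ∈ θ, cTr y) ∧ ∀ β ∈ θ, ¬ Inj S θ β

theorem DD.cCard (i : Fin n) : DD n (fun S v => cCard.{u} S (v i)) := by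
  unfold _root_.cCard
  repeat' first
    | apply DD.cTr
    | apply DD.Inj
    | apply DD.iff
    | apply DD.not
    | apply DD.exS
    | apply DD.allS
    | apply DD.bex
    | apply DD.ball
    | apply DD.and
    | apply DD.or
    | apply DD.imp
    | apply DD.eq
    | apply DD.mem

/-- `M = H(θ)`, relative to `S` -/
def cH (S : Set ZFSet.{u}) (θ M : ZFSet.{u}) : Prop :=
  ∀ x ∈ S, x ∈ M ↔ ∃ t ∈ S, cTr t ∧ (∀ y ∈ x, y ∈ t) ∧ ¬ Inj S θ t

theorem DD.cH (i j : Fin n) : DD n (fun S v => cH.{u} S (v i) (v j)) := by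
  unfold _root_.cH
  repeat' first
    | apply DD.cTr
    | apply DD.Inj
    | apply DD.iff
    | apply DD.not
    | apply DD.exS
    | apply DD.allS
    | apply DD.bex
    | apply DD.ball
    | apply DD.and
    | apply DD.or
    | apply DD.imp
    | apply DD.eq
    | apply DD.mem

/-- empty set -/
def cEmp (o : ZFSet.{u}) : Prop := ∀ y ∈ o, ¬ y ∈ o

theorem DD.cEmp (i : Fin n) : DD n (fun (_ : Set ZFSet.{u}) v => cEmp (v i)) := by
  unfold _root_.cEmp
  repeat' first
    | apply DD.iff
    | apply DD.not
    | apply DD.exS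
    | apply DD.allS
    | apply DD.bex
    | apply DD.ball
    | apply DD.and
    | apply DD.or
    | apply DD.imp
    | apply DD.eq
    | apply DD.mem

/-- successor -/
def cSucc (i s : ZFSet.{u}) : Prop := (∀ y ∈ s, y ∈ i ∨ y = i) ∧ (∀ y ∈ i, y ∈ s) ∧ i ∈ s

theorem DD.cSucc (i j : Fin n) : DD n (fun (_ : Set ZFSet.{u}) v => cSucc (v i) (v j)) := by
  unfold _root_.cSucc
  repeat' first
    | apply DD.iff
    | apply DD.not
    | apply DD.exS
    | apply DD.allS
    | apply DD.bex
    | apply DD.ball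
    | apply DD.and
    | apply DD.or
    | apply DD.imp
    | apply DD.eq
    | apply DD.mem

theorem cEmp_iff (o : ZFSet.{u}) : cEmp o ↔ o = ∅ := by
  rw [ZFSet.eq_empty]
  exact ⟨fun h y hy => h y hy hy, fun h y hy => h y⟩

theorem cSucc_iff (i s : ZFSet.{u}) : cSucc i s ↔ s = insert i i := by
  constructor
  · rintro ⟨h1, h2, h3⟩
    ext y
    rw [ZFSet.mem_insert_iff]
    refine ⟨fun h => (h1 y h).symm, ?_⟩
    rintro (rfl | h)
    · exact h3
    · exact h2 y h
  · rintro rfl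
    exact ⟨fun y hy => (ZFSet.mem_insert_iff.1 hy).symm, fun y hy => by simp [hy], by simp⟩

/-- inductive set -/
def cInd (I : ZFSet.{u}) : Prop := (∃ o ∈ I, cEmp o) ∧ ∀ i ∈ I, ∃ s ∈ I, cSucc i s

theorem DD.cInd (i : Fin n) : DD n (fun (_ : Set ZFSet.{u}) v => cInd (v i)) := by
  unfold _root_.cInd
  repeat' first
    | apply DD.cEmp
    | apply DD.cSucc
    | apply DD.iff
    | apply DD.not
    | apply DD.exS
    | apply DD.allS
    | apply DD.bex
    | apply DD.ball
    | apply DD.and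
    | apply DD.or
    | apply DD.imp
    | apply DD.eq
    | apply DD.mem

/-- pairing function on `κ` -/
def cP (κ p : ZFSet.{u}) : Prop :=
  (∀ α ∈ κ, ∀ β ∈ κ, ∃ γ ∈ κ, P3 p α β γ) ∧
    ∀ α ∈ κ, ∀ β ∈ κ, ∀ γ ∈ κ, P3 p α β γ →
      ∀ δ ∈ κ, δ ∈ γ ↔ ∃ α' ∈ κ, ∃ β' ∈ κ, cGO α' β' α β ∧ P3 p α' β' δ

theorem DD.cP (i j : Fin n) : DD n (fun (_ : Set ZFSet.{u}) v => cP (v i) (v j)) := by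
  unfold _root_.cP
  repeat' first
    | apply DD.P3
    | apply DD.cGO
    | apply DD.iff
    | apply DD.not
    | apply DD.exS
    | apply DD.allS
    | apply DD.bex
    | apply DD.ball
    | apply DD.and
    | apply DD.or
    | apply DD.imp
    | apply DD.eq
    | apply DD.mem

/-- the enumeration `b` -/
def cB (κ M p b : ZFSet.{u}) : Prop :=
  (∀ α ∈ κ, ∃ x ∈ M, ZFSet.pair α x ∈ b) ∧
  (∀ α ∈ κ, ∀ x ∈ M, ∀ y ∈ M, ZFSet.pair α x ∈ b → ZFSet.pair α y ∈ b → x = y) ∧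
  (∀ o ∈ κ, cEmp o → ∀ α ∈ κ, ∀ γ ∈ κ, P3 p o α γ → ZFSet.pair γ α ∈ b) ∧
  (∀ o ∈ κ, ∀ e ∈ κ, cEmp o → cSucc o e → ∀ γ ∈ κ, P3 p e o γ → ZFSet.pair γ κ ∈ b)

theorem DD.cB (i j k l : Fin n) :
    DD n (fun (_ : Set ZFSet.{u}) v => cB (v i) (v j) (v k) (v l)) := by
  unfold _root_.cB
  repeat' first
    | apply DD.P3
    | apply DD.cEmp
    | apply DD.cSucc
    | apply DD.pm
    | apply DD.iff
    | apply DD.not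
    | apply DD.exS
    | apply DD.allS
    | apply DD.bex
    | apply DD.ball
    | apply DD.and
    | apply DD.or
    | apply DD.imp
    | apply DD.eq
    | apply DD.mem

/-- `A` codes the membership relation -/
def cA (κ M p b A : ZFSet.{u}) : Prop :=
  ∀ α ∈ κ, ∀ β ∈ κ, ∀ γ ∈ κ, P3 p α β γ →
    (γ ∈ A ↔ ∃ x ∈ M, ∃ y ∈ M, ZFSet.pair α x ∈ b ∧ ZFSet.pair β y ∈ b ∧ x ∈ y)

theorem DD.cA (i j k l m : Fin n) :
    DD n (fun (_ : Set ZFSet.{u}) v => cA (v i) (v j) (v k) (v l) (v m)) := by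
  unfold _root_.cA
  repeat' first
    | apply DD.P3
    | apply DD.pm
    | apply DD.iff
    | apply DD.not
    | apply DD.exS
    | apply DD.allS
    | apply DD.bex
    | apply DD.ball
    | apply DD.and
    | apply DD.or
    | apply DD.imp
    | apply DD.eq
    | apply DD.mem

/-- `v` is a valuation -/
def cV (I M v : ZFSet.{u}) : Prop :=
  (∀ i ∈ I, ∃ x ∈ M, ZFSet.pair i x ∈ v) ∧
  (∀ i ∈ I, ∀ x ∈ M, ∀ y ∈ M, ZFSet.pair i x ∈ v → ZFSet.pair i y ∈ v → x = y) ∧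
  (∀ q ∈ v, ∃ i ∈ I, ∃ x ∈ M, q = ZFSet.pair i x)

theorem DD.cV (i j k : Fin n) :
    DD n (fun (_ : Set ZFSet.{u}) v => cV (v i) (v j) (v k)) := by
  unfold _root_.cV
  repeat' first
    | apply DD.pm
    | apply DD.cOP
    | apply DD.iff
    | apply DD.not
    | apply DD.exS
    | apply DD.allS
    | apply DD.bex
    | apply DD.ball
    | apply DD.and
    | apply DD.or
    | apply DD.imp
    | apply DD.eq
    | apply DD.mem

/-- `v` and `w` agree off `i` -/
def cU (I M i v w : ZFSet.{u}) : Prop :=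
  ∀ i' ∈ I, ¬ i' = i → ∀ x ∈ M, (ZFSet.pair i' x ∈ v ↔ ZFSet.pair i' x ∈ w)

theorem DD.cU (i j k l m : Fin n) :
    DD n (fun (_ : Set ZFSet.{u}) v => cU (v i) (v j) (v k) (v l) (v m)) := by
  unfold _root_.cU
  repeat' first
    | apply DD.pm
    | apply DD.iff
    | apply DD.not
    | apply DD.exS
    | apply DD.allS
    | apply DD.bex
    | apply DD.ball
    | apply DD.and
    | apply DD.or
    | apply DD.imp
    | apply DD.eq
    | apply DD.mem

/-- atomic and propositional closure of the family `D` -/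
def cD1 (S : Set ZFSet.{u}) (M I D : ZFSet.{u}) : Prop :=
  (∀ i ∈ I, ∀ j ∈ I, ∃ R ∈ D, ∀ v ∈ S, cV I M v →
    (v ∈ R ↔ ∃ x ∈ M, ∃ y ∈ M, ZFSet.pair i x ∈ v ∧ ZFSet.pair j y ∈ v ∧ x ∈ y)) ∧
  (∀ i ∈ I, ∀ j ∈ I, ∃ R ∈ D, ∀ v ∈ S, cV I M v →
    (v ∈ R ↔ ∃ x ∈ M, ZFSet.pair i x ∈ v ∧ ZFSet.pair j x ∈ v)) ∧
  (∀ R ∈ D, ∃ R' ∈ D, ∀ v ∈ S, cV I M v → (v ∈ R' ↔ ¬ v ∈ R)) ∧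
  (∀ R ∈ D, ∀ Q ∈ D, ∃ R' ∈ D, ∀ v ∈ S, cV I M v → (v ∈ R' ↔ v ∈ R ∧ v ∈ Q))

theorem DD.cD1 (i j k : Fin n) :
    DD n (fun S v => cD1.{u} S (v i) (v j) (v k)) := by
  unfold _root_.cD1
  repeat' first
    | apply DD.cV
    | apply DD.pm
    | apply DD.iff
    | apply DD.not
    | apply DD.exS
    | apply DD.allS
    | apply DD.bex
    | apply DD.ball
    | apply DD.and
    | apply DD.or
    | apply DD.imp
    | apply DD.eq
    | apply DD.mem

/-- projections and the Tarski-Vaught condition for the family `D` -/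
def cD2 (S : Set ZFSet.{u}) (κ M I b D : ZFSet.{u}) : Prop :=
  (∀ R ∈ D, ∀ i ∈ I, ∃ R' ∈ D, ∀ v ∈ S, cV I M v →
    (v ∈ R' ↔ ∃ w ∈ S, cV I M w ∧ cU I M i v w ∧ w ∈ R)) ∧
  (∀ R ∈ D, ∀ i ∈ I, ∀ v ∈ S, cV I M v →
    (∀ i' ∈ I, ∃ x ∈ M, ∃ α ∈ κ, ZFSet.pair i' x ∈ v ∧ ZFSet.pair α x ∈ b) →
    (∃ w ∈ S, cV I M w ∧ cU I M i v w ∧ w ∈ R) →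
    ∃ w ∈ S, cV I M w ∧ cU I M i v w ∧ w ∈ R ∧
      ∃ x ∈ M, ∃ α ∈ κ, ZFSet.pair i x ∈ w ∧ ZFSet.pair α x ∈ b)

theorem DD.cD2 (i j k l m : Fin n) :
    DD n (fun S v => cD2.{u} S (v i) (v j) (v k) (v l) (v m)) := by
  unfold _root_.cD2
  repeat' first
    | apply DD.cV
    | apply DD.cU
    | apply DD.pm
    | apply DD.iff
    | apply DD.not
    | apply DD.exS
    | apply DD.allS
    | apply DD.bex
    | apply DD.ball
    | apply DD.and
    | apply DD.or
    | apply DD.imp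
    | apply DD.eq
    | apply DD.mem

/-- the reflected statement -/
def cQ (S : Set ZFSet.{u}) (A κ : ZFSet.{u}) : Prop :=
  ∃ θ ∈ S, ∃ M ∈ S, ∃ I ∈ S, ∃ D ∈ S, ∃ p ∈ S, ∃ b ∈ S,
    cCard S θ ∧ κ ∈ θ ∧ cH S θ M ∧ cInd I ∧ cInd κ ∧ cP κ p ∧ cB κ M p b ∧ cA κ M p b A ∧
      cD1 S M I D ∧ cD2 S κ M I b D

theorem DD.cQ (i j : Fin n) : DD n (fun S v => cQ.{u} S (v i) (v j)) := by
  unfold _root_.cQ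
  repeat' first
    | apply DD.cCard
    | apply DD.cH
    | apply DD.cInd
    | apply DD.cP
    | apply DD.cB
    | apply DD.cA
    | apply DD.cD1
    | apply DD.cD2
    | apply DD.iff
    | apply DD.not
    | apply DD.exS
    | apply DD.allS
    | apply DD.bex
    | apply DD.ball
    | apply DD.and
    | apply DD.or
    | apply DD.imp
    | apply DD.eq
    | apply DD.mem

theorem cQ_formula : ∃ φ : SF, φ.fv ⊆ {0, 1} ∧ ∀ S : Set ZFSet.{u}, STr S → ∀ A ∈ S, ∀ κ ∈ S,
    (SatIn ∅ S φ (val2 A κ) ↔ cQ S A κ) := by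
  obtain ⟨φ, hφ, h⟩ := DD.cQ.{u} (n := 2) 0 1
  refine ⟨φ, ?_, fun S hS A hA κ hκ => ?_⟩
  · intro i hi
    have := hφ i hi
    simp only [Set.mem_insert_iff, Set.mem_singleton_iff]
    omega
  · have := h S hS ![A, κ] (by intro i; fin_cases i <;> simpa)
    rw [← show extv ![A, κ] = val2 A κ from ?_]
    · simpa using this
    · funext i
      rcases i with _ | _ | i
      · simp [extv, val2]
      · simp [extv, val2]
      · simp [extv, val2]

end definability

section common

theorem cTr_iff (x : ZFSet.{u}) : cTr x ↔ x.IsTransitive :=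
  ⟨fun h y hy w hw => h y hy w hw, fun h y hy w hw => h y hy hw⟩

theorem cCard_iff {ν θ : ZFSet.{u}} (hν : ℵ₀ ≤ ν.card) (hθ : θ ∈ HSet ν) :
    cCard (HSet ν) θ ↔ ZCard θ := by
  simp only [cCard, ZCard, ZOrd, cTr_iff, and_assoc, card_lt_iff']
  refine and_congr_right fun _ => and_congr_right fun _ => forall₂_congr fun β hβ => ?_
  rw [Inj_iff hν hθ (STr_HSet ν _ hθ _ hβ), not_le]

theorem cH_iff {ν θ M : ZFSet.{u}} (hν : ℵ₀ ≤ ν.card) (hθ : θ ∈ HSet ν) (hM : M ∈ HSet ν) :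
    cH (HSet ν) θ M ↔ ∀ x, x ∈ M ↔ x ∈ HSet θ := by
  have hc := card_lt_of_mem_HSet hθ
  have key : ∀ x : ZFSet.{u}, (∃ t ∈ HSet ν, cTr t ∧ (∀ y ∈ x, y ∈ t) ∧ ¬ Inj (HSet ν) θ t) ↔
      x ∈ HSet θ := by
    intro x
    rw [mem_HSet']
    constructor
    · rintro ⟨t, ht, h1, h2, h3⟩
      rw [Inj_iff hν hθ ht, not_le] at h3
      exact ⟨t, (cTr_iff t).1 h1, fun y hy => h2 y hy, h3⟩
    · rintro ⟨t, h1, h2, h3⟩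
      have ht : t ∈ HSet ν := mem_HSet_of_trans h1 (h3.trans hc)
      refine ⟨t, ht, (cTr_iff t).2 h1, fun y hy => h2 hy, ?_⟩
      rw [Inj_iff hν hθ ht, not_le]; exact h3
  simp only [cH, key]
  constructor
  · intro h x
    refine ⟨fun hx => (h x (STr_HSet ν _ hM _ hx)).1 hx, fun hx => (h x ?_).2 hx⟩
    exact HSet_mono hc.le hx
  · intro h x _; exact h x

theorem cInd_num {I : ZFSet.{u}} (h : cInd I) (n : ℕ) : num n ∈ I := by
  apply num_mem_of_inductive
  · obtain ⟨o, ho, h'⟩ := h.1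
    rw [cEmp_iff] at h'; rwa [← h']
  · intro i hi
    obtain ⟨s, hs, h'⟩ := h.2 i hi
    rw [cSucc_iff] at h'; rwa [← h']

theorem card_of_num {I : ZFSet.{u}} (h : ∀ n, num n ∈ I) : ℵ₀ ≤ I.card := by
  rw [← Cardinal.lift_le.{u+1}, ← ZFSet.cardinalMk_coe_sort, Cardinal.lift_aleph0,
    Cardinal.aleph0_le_mk_iff]
  exact Infinite.of_injective (fun n : ℕ => (⟨num n, h n⟩ : I))
    (fun a b hab => num_inj.1 (congrArg Subtype.val hab))

/-- the external valuation coded by a set -/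
noncomputable def extn (v : ZFSet.{u}) (n : ℕ) : ZFSet.{u} :=
  open Classical in if h : ∃ x, ZFSet.pair (num n) x ∈ v then h.choose else ∅

variable {I M : ZFSet.{u}}

theorem cV_subset {v : ZFSet.{u}} (hv : cV I M v) : v ⊆ ZFSet.prod I M := by
  intro q hq
  obtain ⟨i, hi, x, hx, rfl⟩ := hv.2.2 q hq
  exact ZFSet.pair_mem_prod.2 ⟨hi, hx⟩

theorem cV_mem {v i x : ZFSet.{u}} (hv : cV I M v) (h : ZFSet.pair i x ∈ v) : i ∈ I ∧ x ∈ M :=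
  ZFSet.pair_mem_prod.1 (cV_subset hv h)

theorem extn_spec (hI : ∀ n, num n ∈ I) {v : ZFSet.{u}} (hv : cV I M v) (n : ℕ) (x : ZFSet.{u}) :
    ZFSet.pair (num n) x ∈ v ↔ x = extn v n := by
  obtain ⟨y, hy, hyv⟩ := hv.1 _ (hI n)
  have hex : ∃ x, ZFSet.pair (num n) x ∈ v := ⟨y, hyv⟩
  have h1 : ZFSet.pair (num n) (extn v n) ∈ v := by
    unfold extn; rw [dif_pos hex]; exact hex.choose_spec
  constructor
  · intro h
    exact hv.2.1 _ (hI n) _ (cV_mem hv h).2 _ (cV_mem hv h1).2 h h1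
  · rintro rfl; exact h1

theorem extn_mem (hI : ∀ n, num n ∈ I) {v : ZFSet.{u}} (hv : cV I M v) (n : ℕ) : extn v n ∈ M :=
  (cV_mem hv ((extn_spec hI hv n _).2 rfl)).2

/-- valuation from a function -/
noncomputable def mkv (I M : ZFSet.{u}) (F : ZFSet.{u} → ZFSet.{u}) : ZFSet.{u} :=
  ZFSet.sep (fun q => ∃ i, q = ZFSet.pair i (F i)) (ZFSet.prod I M)

theorem pair_mem_mkv (F : ZFSet.{u} → ZFSet.{u}) (hF : ∀ i ∈ I, F i ∈ M) (i x : ZFSet.{u}) :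
    ZFSet.pair i x ∈ mkv I M F ↔ i ∈ I ∧ x = F i := by
  simp only [mkv, ZFSet.mem_sep, ZFSet.pair_mem_prod, ZFSet.pair_inj]
  constructor
  · rintro ⟨⟨h1, h2⟩, j, rfl, rfl⟩; exact ⟨h1, rfl⟩
  · rintro ⟨h1, rfl⟩; exact ⟨⟨h1, hF i h1⟩, i, rfl, rfl⟩

theorem mkv_subset (F : ZFSet.{u} → ZFSet.{u}) : mkv I M F ⊆ ZFSet.prod I M :=
  fun q hq => (ZFSet.mem_sep.1 hq).1

theorem cV_mkv (F : ZFSet.{u} → ZFSet.{u}) (hF : ∀ i ∈ I, F i ∈ M) : cV I M (mkv I M F) := by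
  refine ⟨fun i hi => ⟨F i, hF i hi, ?_⟩, fun i hi x _ y _ h1 h2 => ?_, fun q hq => ?_⟩
  · rw [pair_mem_mkv F hF]; exact ⟨hi, rfl⟩
  · rw [pair_mem_mkv F hF] at h1 h2
    rw [h1.2, h2.2]
  · obtain ⟨h, i, rfl⟩ := ZFSet.mem_sep.1 hq
    exact ⟨i, (ZFSet.pair_mem_prod.1 h).1, _, (ZFSet.pair_mem_prod.1 h).2, rfl⟩

theorem extn_mkv (hI : ∀ n, num n ∈ I) (F : ZFSet.{u} → ZFSet.{u}) (hF : ∀ i ∈ I, F i ∈ M) (n : ℕ) :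
    extn (mkv I M F) n = F (num n) := by
  have := (extn_spec hI (cV_mkv F hF) n _).2 rfl
  rw [pair_mem_mkv F hF] at this
  exact this.2

theorem exists_val (hI : ∀ n, num n ∈ I) (f : ℕ → ZFSet.{u}) (hf : ∀ n, f n ∈ M) :
    ∃ F : ZFSet.{u} → ZFSet.{u}, (∀ i, ∃ n, F i = f n) ∧ cV I M (mkv I M F) ∧ 
      extn (mkv I M F) = f := by
  classical
  let F : ZFSet.{u} → ZFSet.{u} := fun i => if h : ∃ n, i = num n then f h.choose else f 0
  have hF' : ∀ i, ∃ n, F i = f n := by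
    intro i
    by_cases h : ∃ n, i = num n
    · exact ⟨_, dif_pos h⟩
    · exact ⟨0, dif_neg h⟩
  have hF : ∀ i ∈ I, F i ∈ M := by
    intro i _
    obtain ⟨n, hn⟩ := hF' i
    rw [hn]; exact hf n
  refine ⟨F, hF', cV_mkv F hF, funext fun n => ?_⟩
  rw [extn_mkv hI F hF]
  have h : ∃ m : ℕ, (num n : ZFSet.{u}) = num m := ⟨n, rfl⟩
  have : F (num n) = f h.choose := dif_pos h
  rw [this, ← num_inj.1 h.choose_spec]

theorem exists_upd (hI : ∀ n, num n ∈ I) {v x : ZFSet.{u}} (hv : cV I M v) (n : ℕ) (hx : x ∈ M) :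
    ∃ w, w ⊆ ZFSet.prod I M ∧ cV I M w ∧ cU I M (num n) v w ∧
      extn w = Function.update (extn v) n x := by
  classical
  choose! g hg hgv using hv.1
  have hg' : ∀ i ∈ I, ∀ y ∈ M, ZFSet.pair i y ∈ v ↔ y = g i := fun i hi y hy =>
    ⟨fun h => hv.2.1 i hi y hy _ (hg i hi) h (hgv i hi), fun h => h ▸ hgv i hi⟩
  let F : ZFSet.{u} → ZFSet.{u} := fun i => if i = num n then x else g i
  have hF : ∀ i ∈ I, F i ∈ M := by
    intro i hi
    by_cases h : i = num n
    · simp only [F, if_pos h]; exact hx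
    · simp only [F, if_neg h]; exact hg i hi
  refine ⟨mkv I M F, mkv_subset F, cV_mkv F hF, ?_, ?_⟩
  · intro i hi hne y hy
    rw [pair_mem_mkv F hF, hg' i hi y hy]
    simp [F, hne, hi]
  · funext m
    rw [extn_mkv hI F hF]
    by_cases h : m = n
    · subst h; simp [F]
    · rw [Function.update_of_ne h]
      have : (num m : ZFSet.{u}) ≠ num n := fun h' => h (num_inj.1 h')
      simp only [F, if_neg this]
      exact (extn_spec hI hv m _).1 (hgv _ (hI m))

theorem cU_upd (hI : ∀ n, num n ∈ I) {v w : ZFSet.{u}} (hv : cV I M v) (hw : cV I M w) {n : ℕ}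
    (h : cU I M (num n) v w) : extn w = Function.update (extn v) n (extn w n) := by
  funext m
  by_cases hm : m = n
  · subst hm; simp
  · rw [Function.update_of_ne hm]
    have hne : (num m : ZFSet.{u}) ≠ num n := fun h' => hm (num_inj.1 h')
    have := (h _ (hI m) hne _ (extn_mem hI hw m)).2 ((extn_spec hI hw m _).2 rfl)
    exact (extn_spec hI hv m _).1 this

/-- class of elements -/
def MS (M : ZFSet.{u}) : Set ZFSet.{u} := {x | x ∈ M}

theorem ex_clause (hI : ∀ n, num n ∈ I) {S : Set ZFSet.{u}} (hS : ∀ f, f ⊆ ZFSet.prod I M → f ∈ S)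
    {v : ZFSet.{u}} (hv : cV I M v) (n : ℕ) (Φ : (ℕ → ZFSet.{u}) → Prop) :
    (∃ x ∈ M, Φ (Function.update (extn v) n x)) ↔
      ∃ w ∈ S, cV I M w ∧ cU I M (num n) v w ∧ Φ (extn w) := by
  constructor
  · rintro ⟨x, hx, h⟩
    obtain ⟨w, h1, h2, h3, h4⟩ := exists_upd hI hv n hx
    exact ⟨w, hS w h1, h2, h3, h4 ▸ h⟩
  · rintro ⟨w, -, h2, h3, h4⟩
    refine ⟨extn w n, extn_mem hI h2 n, ?_⟩
    rw [← cU_upd hI hv h2 h3]; exact h4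

theorem D_sat (hI : ∀ n, num n ∈ I) {S : Set ZFSet.{u}} (hS : ∀ f, f ⊆ ZFSet.prod I M → f ∈ S)
    {D κ b : ZFSet.{u}} (h1 : cD1 S M I D) (h2 : cD2 S κ M I b D) (φ : SF) :
    ∃ R ∈ D, ∀ v ∈ S, cV I M v → (v ∈ R ↔ SatIn ∅ (MS M) φ (extn v)) := by
  unfold SatIn
  obtain ⟨d1, d2, d3, d4⟩ := h1
  induction φ with
  | mem i j =>
    obtain ⟨R, hR, h⟩ := d1 _ (hI i) _ (hI j)
    refine ⟨R, hR, fun v hvS hv => (h v hvS hv).trans ?_⟩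
    simp only [extn_spec hI hv, Sat]
    constructor
    · rintro ⟨x, -, y, -, rfl, rfl, h⟩; exact h
    · intro h
      exact ⟨_, extn_mem hI hv i, _, extn_mem hI hv j, rfl, rfl, h⟩
  | eq i j =>
    obtain ⟨R, hR, h⟩ := d2 _ (hI i) _ (hI j)
    refine ⟨R, hR, fun v hvS hv => (h v hvS hv).trans ?_⟩
    simp only [extn_spec hI hv, Sat]
    constructor
    · rintro ⟨x, -, rfl, h⟩; exact h
    · intro h
      exact ⟨_, extn_mem hI hv i, rfl, h⟩
  | pred i =>
    obtain ⟨R, hR, -⟩ := d1 _ (hI 0) _ (hI 0)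
    obtain ⟨R1, hR1, h1⟩ := d3 R hR
    obtain ⟨R2, hR2, h2⟩ := d4 R hR R1 hR1
    refine ⟨R2, hR2, fun v hvS hv => (h2 v hvS hv).trans ?_⟩
    rw [h1 v hvS hv]
    simp [Sat]
  | not φ ih =>
    obtain ⟨R, hR, h⟩ := ih
    obtain ⟨R1, hR1, h1⟩ := d3 R hR
    refine ⟨R1, hR1, fun v hvS hv => (h1 v hvS hv).trans ?_⟩
    rw [h v hvS hv]; rfl
  | and φ ψ ih1 ih2 =>
    obtain ⟨R, hR, h⟩ := ih1
    obtain ⟨R', hR', h'⟩ := ih2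
    obtain ⟨R1, hR1, h1⟩ := d4 R hR R' hR'
    refine ⟨R1, hR1, fun v hvS hv => (h1 v hvS hv).trans ?_⟩
    rw [h v hvS hv, h' v hvS hv]; rfl
  | ex n φ ih =>
    obtain ⟨R, hR, h⟩ := ih
    obtain ⟨R1, hR1, h1⟩ := h2.1 R hR _ (hI n)
    refine ⟨R1, hR1, fun v hvS hv => (h1 v hvS hv).trans ?_⟩
    have := ex_clause hI hS hv n (fun f => Sat ∅ (· ∈ ·) (MS M) φ f)
    refine Iff.trans ?_ this.symm
    refine exists_congr fun w => and_congr_right fun hwS => and_congr_right fun hw => 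
      and_congr_right fun _ => h w hwS hw

theorem TV_sub (hI : ∀ n, num n ∈ I) {S : Set ZFSet.{u}} (hS : ∀ f, f ⊆ ZFSet.prod I M → f ∈ S)
    {D κ b : ZFSet.{u}} (h1 : cD1 S M I D) (h2 : cD2 S κ M I b D) :
    ElemSub ∅ {x | x ∈ M ∧ ∃ α ∈ κ, ZFSet.pair α x ∈ b} (MS M) := by
  apply tarski_vaught
  · rintro x ⟨h, -⟩; exact h
  intro φ n f hf hex
  obtain ⟨F, hF, hv, rfl⟩ := exists_val hI f (fun n => (hf n).1)
  set v := mkv I M F with hvdef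
  have hFM : ∀ i ∈ I, F i ∈ M := by
    intro i _
    obtain ⟨n, hn⟩ := hF i
    rw [hn]; exact (hf n).1
  have hvS : v ∈ S := hS _ (mkv_subset F)
  obtain ⟨R, hR, hRφ⟩ := D_sat hI hS h1 h2 φ
  have := (ex_clause hI hS hv n (fun f => SatIn ∅ (MS M) φ f)).1 hex
  obtain ⟨w, hwS, hw, hu, hwφ⟩ := this
  obtain ⟨w', hw'S, hw', hu', hwR, x, hx, α, hα, hxw, hαb⟩ := h2.2 R hR _ (hI n) v hvS hv
    (fun i hi => by
      obtain ⟨m, hm⟩ := hF i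
      obtain ⟨h1, α, hα, h2⟩ := hf m
      refine ⟨_, h1, α, hα, ?_, h2⟩
      rw [hvdef, pair_mem_mkv F hFM]; exact ⟨hi, hm.symm⟩)
    ⟨w, hwS, hw, hu, (hRφ w hwS hw).2 hwφ⟩
  rw [extn_spec hI hw'] at hxw
  subst hxw
  refine ⟨_, ⟨hx, α, hα, hαb⟩, ?_⟩
  rw [← cU_upd hI hv hw' hu']
  exact (hRφ _ hw'S hw').1 hwR

end common

section reflectSide

theorem GO_bd {k : Ordinal.{u}} {x y : Ordinal.{u} × Ordinal.{u}} (h : GO x y) (h1 : y.1 < k)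
    (h2 : y.2 < k) : x.1 < k ∧ x.2 < k := by
  rw [GO_def] at h
  rw [← max_lt_iff]
  have : max x.1 x.2 ≤ max y.1 y.2 := by
    rcases h with h | h
    · exact h.le
    · exact h.1.le
  exact this.trans_lt (max_lt h1 h2)

theorem cP_gp {k : Ordinal.{u}} {p : ZFSet.{u}} (h : cP k.toZFSet p) (y : Ordinal.{u} × Ordinal.{u}) :
    y.1 < k → y.2 < k → ∀ c < k, P3 p y.1.toZFSet y.2.toZFSet c.toZFSet → c = gpair y := by
  have tm : ∀ {a : Ordinal.{u}}, a < k → a.toZFSet ∈ k.toZFSet :=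
    fun h => Ordinal.toZFSet_mem_toZFSet_iff.2 h
  induction y using GO_wf.induction with
  | _ y ih =>
  intro hy1 hy2 c hc hp
  have h2 := h.2 _ (tm hy1) _ (tm hy2) _ (tm hc) hp
  apply le_antisymm
  · by_contra hlt
    rw [not_le] at hlt
    have := (h2 _ (tm (hlt.trans hc))).1 (Ordinal.toZFSet_mem_toZFSet_iff.2 hlt)
    obtain ⟨α, hα, β, hβ, hg, hq⟩ := this
    obtain ⟨a, ha, rfl⟩ := Ordinal.mem_toZFSet_iff.1 hα
    obtain ⟨b, hb, rfl⟩ := Ordinal.mem_toZFSet_iff.1 hβ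
    rw [cGO_iff] at hg
    have := ih (a, b) hg ha hb _ (hlt.trans hc) hq
    exact (gpair_lt hg).ne this.symm
  · by_contra hlt
    rw [not_le] at hlt
    obtain ⟨x, hx, hxc⟩ := (lt_gpair y c).1 hlt
    obtain ⟨hx1, hx2⟩ := GO_bd hx hy1 hy2
    obtain ⟨γ, hγ, hq⟩ := h.1 _ (tm hx1) _ (tm hx2)
    obtain ⟨d, hd, rfl⟩ := Ordinal.mem_toZFSet_iff.1 hγ
    have hdx := ih x hx hx1 hx2 d hd hq
    have : d.toZFSet ∈ c.toZFSet := (h2 _ (tm hd)).2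
      ⟨_, tm hx1, _, tm hx2, (cGO_iff x.1 x.2 y.1 y.2).2 hx, hq⟩
    rw [Ordinal.toZFSet_mem_toZFSet_iff, hdx, hxc] at this
    exact lt_irrefl _ this

theorem reflect {ν A' κ z θ : ZFSet.{u}} {k : Ordinal.{u}} (hκν : k.toZFSet ∈ HSet ν)
    (hQ : cQ (HSet ν) A' k.toZFSet)
    (hM : ∀ α < k, hull κ z (HSet θ) α ∈ HSet θ)
    (hA : ∀ a < k, ∀ b < k, gp a b < k →
      ((gp a b).toZFSet ∈ A' ↔ hull κ z (HSet θ) a ∈ hull κ z (HSet θ) b)) :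
    ∃ (θ' : ZFSet.{u}) (X : Set ZFSet.{u}) (j : ZFSet.{u} → ZFSet.{u}),
      ZCard θ' ∧ k.toZFSet ∈ θ' ∧ ElemSub ∅ X (HSet θ') ∧ ElemEmbOn ∅ X (HSet θ) j ∧
          (∀ β ∈ k.toZFSet, β ∈ X) ∧ k.toZFSet ∈ X ∧
          (∀ β ∈ k.toZFSet, j β = β) ∧ j k.toZFSet = κ ∧ ∃ x ∈ X, j x = z := by
  classical
  obtain ⟨θ', hθ', M, hMν, I, hIν, D, hD, p, hp, b, hb, q1, q2, q3, q4, q5, q6, q7, q8, q9, q10⟩ := hQ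
  have hI := cInd_num q4
  have hν : ℵ₀ ≤ ν.card := (card_of_num hI).trans (card_lt_of_mem_HSet hIν).le
  rw [cCard_iff hν hθ'] at q1
  rw [cH_iff hν hθ' hMν] at q3
  have hMS : MS M = HSet θ' := Set.ext q3
  have hS : ∀ f, f ⊆ ZFSet.prod I M → f ∈ HSet ν := fun f hf => HSet_prod hν hIν hMν hf
  have tm : ∀ {a : Ordinal.{u}}, a < k → a.toZFSet ∈ k.toZFSet :=
    fun h => Ordinal.toZFSet_mem_toZFSet_iff.2 h
  have hgp : ∀ a < k, ∀ b < k, ∀ c < k, P3 p a.toZFSet b.toZFSet c.toZFSet → c = gp a b :=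
    fun a ha b hb c hc h => cP_gp q6 (a, b) ha hb c hc h
  have hgp2 : ∀ a < k, ∀ b < k, gp a b < k ∧ P3 p a.toZFSet b.toZFSet (gp a b).toZFSet := by
    intro a ha b hb
    obtain ⟨γ, hγ, h⟩ := q6.1 _ (tm ha) _ (tm hb)
    obtain ⟨c, hc, rfl⟩ := Ordinal.mem_toZFSet_iff.1 hγ
    have := hgp a ha b hb c hc h
    subst this
    exact ⟨hc, h⟩
  have hk : PClosed k := by
    refine ⟨?_, fun a ha b hb => (hgp2 a ha b hb).1⟩
    rw [Ordinal.omega0_le]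
    intro n
    exact (Ordinal.toZFSet_mem_toZFSet_iff.1 (cInd_num q5 n)).le
  have hk1 : 1 < k := Ordinal.one_lt_omega0.trans_le hk.1
  have hk0 := hk.zero_lt
  -- the enumeration
  obtain ⟨b1, b2, b3, b4⟩ := q7
  choose! f hfM hfb using b1
  let g : Ordinal.{u} → ZFSet.{u} := fun α => f α.toZFSet
  have hgM : ∀ α < k, g α ∈ M := fun α hα => hfM _ (tm hα)
  have hg : ∀ α < k, ∀ x, x ∈ M → (ZFSet.pair α.toZFSet x ∈ b ↔ x = g α) := fun α hα x hx =>
    ⟨fun h => b2 _ (tm hα) x hx _ (hgM α hα) h (hfb _ (tm hα)), fun h => h ▸ hfb _ (tm hα)⟩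
  have hkM : k.toZFSet ∈ M := by
    rw [q3]
    exact mem_HSet_of_trans (ZFSet.isOrdinal_toZFSet k).isTransitive
      (((ZCard_iff _).1 q1).2 _ q2)
  have hoM : ∀ α < k, α.toZFSet ∈ M := fun α hα => by
    rw [q3]
    exact STr_HSet θ' _ ((q3 _).1 hkM) _ (tm hα)
  have hg0 : ∀ α < k, g (gp 0 α) = α.toZFSet := by
    intro α hα
    obtain ⟨h1, h2⟩ := hgp2 0 hk0 α hα
    exact ((hg _ h1 _ (hoM α hα)).1
      (b3 _ (tm hk0) ((cEmp_iff _).2 Ordinal.toZFSet_zero) _ (tm hα) _ (tm h1) h2)).symm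
  have hg1 : g (gp 1 0) = k.toZFSet := by
    obtain ⟨h1, h2⟩ := hgp2 1 hk1 0 hk0
    refine ((hg _ h1 _ hkM).1
      (b4 _ (tm hk0) _ (tm hk1) ((cEmp_iff _).2 Ordinal.toZFSet_zero) ?_ _ (tm h1) h2)).symm
    rw [cSucc_iff, ← Ordinal.toZFSet_add_one, zero_add]
  have hmem : ∀ a < k, ∀ c < k,
      (g a ∈ g c ↔ hull κ z (HSet θ) a ∈ hull κ z (HSet θ) c) := by
    intro a ha c hc
    obtain ⟨h1, h2⟩ := hgp2 a ha c hc
    rw [← hA a ha c hc h1, q8 _ (tm ha) _ (tm hc) _ (tm h1) h2]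
    constructor
    · intro h
      exact ⟨_, hgM a ha, _, hgM c hc, hfb _ (tm ha), hfb _ (tm hc), h⟩
    · rintro ⟨x, hx, y, hy, hax, hcy, hxy⟩
      rw [hg a ha x hx] at hax
      rw [hg c hc y hy] at hcy
      rwa [← hax, ← hcy]
  let X : Set ZFSet.{u} := {x | ∃ α < k, g α = x}
  have hXeq : X = {x | x ∈ M ∧ ∃ α ∈ k.toZFSet, ZFSet.pair α x ∈ b} := by
    ext x
    constructor
    · rintro ⟨α, hα, rfl⟩
      exact ⟨hgM α hα, _, tm hα, hfb _ (tm hα)⟩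
    · rintro ⟨hx, α', hα', h⟩
      obtain ⟨α, hα, rfl⟩ := Ordinal.mem_toZFSet_iff.1 hα'
      exact ⟨α, hα, ((hg α hα x hx).1 h).symm⟩
  have hX : ElemSub ∅ X (HSet θ') := by
    rw [hXeq, ← hMS]
    exact TV_sub hI hS q9 q10
  let Y : Set ZFSet.{u} := {x | ∃ α < k, hull κ z (HSet θ) α = x}
  have hY : ElemSub ∅ Y (HSet θ) := hull_elem hk hM
  have heq : ∀ a < k, ∀ c < k,
      (g a = g c ↔ hull κ z (HSet θ) a = hull κ z (HSet θ) c) := by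
    intro a ha c hc
    constructor
    · intro h
      refine elem_ext (STr_HSet θ) hY ⟨a, ha, rfl⟩ ⟨c, hc, rfl⟩ ?_
      rintro _ ⟨d, hd, rfl⟩
      rw [← hmem d hd a ha, ← hmem d hd c hc, h]
    · intro h
      refine elem_ext (STr_HSet θ') hX ⟨a, ha, rfl⟩ ⟨c, hc, rfl⟩ ?_
      rintro _ ⟨d, hd, rfl⟩
      rw [hmem d hd a ha, hmem d hd c hc, h]
  let j : ZFSet.{u} → ZFSet.{u} := fun x =>
    if h : ∃ α < k, g α = x then hull κ z (HSet θ) h.choose else ∅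
  have hj : ∀ α < k, j (g α) = hull κ z (HSet θ) α := by
    intro α hα
    have h : ∃ α' < k, g α' = g α := ⟨α, hα, rfl⟩
    have : j (g α) = hull κ z (HSet θ) h.choose := dif_pos h
    rw [this, ← heq _ h.choose_spec.1 _ hα]
    exact h.choose_spec.2
  refine ⟨θ', X, j, q1, q2, hX, ⟨?_, ?_⟩, ?_, ⟨_, (hgp2 1 hk1 0 hk0).1, hg1⟩, ?_, ?_, ?_⟩
  · rintro _ ⟨α, hα, rfl⟩
    rw [hj α hα]; exact hM α hα
  · intro φ v hv
    have hjY : ∀ x ∈ X, j x ∈ Y := by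
      rintro _ ⟨α, hα, rfl⟩
      exact ⟨α, hα, (hj α hα).symm⟩
    rw [sat_iso (X := X) (Y := Y) (j := j) hjY ?_ ?_ ?_ φ v hv]
    · exact hY.2 φ _ (fun i => hjY _ (hv i))
    · rintro _ ⟨α, hα, rfl⟩
      exact ⟨_, ⟨α, hα, rfl⟩, hj α hα⟩
    · rintro _ ⟨α, hα, rfl⟩ _ ⟨β, hβ, rfl⟩
      rw [hj α hα, hj β hβ, heq α hα β hβ]
    · rintro _ ⟨α, hα, rfl⟩ _ ⟨β, hβ, rfl⟩
      rw [hj α hα, hj β hβ, hmem α hα β hβ]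
  · intro β hβ
    obtain ⟨α, hα, rfl⟩ := Ordinal.mem_toZFSet_iff.1 hβ
    exact ⟨_, (hgp2 0 hk0 α hα).1, hg0 α hα⟩
  · intro β hβ
    obtain ⟨α, hα, rfl⟩ := Ordinal.mem_toZFSet_iff.1 hβ
    have := hj _ (hgp2 0 hk0 α hα).1
    rw [hg0 α hα, hull_zero] at this
    exact this
  · have := hj _ (hgp2 1 hk1 0 hk0).1
    rw [hg1, hull_one] at this
    exact this
  · have h := (hgp2 1 hk1 1 hk1).1
    exact ⟨_, ⟨_, h, rfl⟩, by rw [hj _ h, hull_one_one]⟩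

end reflectSide

section sourceSide

theorem exists_big (x : ZFSet.{u}) : ∃ ν : ZFSet.{u}, ZCard ν ∧ (∀ y ∈ x, y ∈ HSet ν) ∧
    ∀ k : Ordinal.{u}, k.toZFSet ∈ x → k.toZFSet ∈ ν := by
  let t : ZFSet.{u} := ZFSet.vonNeumann x.rank
  let c : Cardinal.{u} := Order.succ t.card
  have hx : ∀ y ∈ x, y ∈ HSet c.ord.toZFSet := by
    apply STr_HSet
    rw [mem_HSet']
    refine ⟨t, ZFSet.isTransitive_vonNeumann _, ?_, ?_⟩
    · rw [ZFSet.subset_vonNeumann]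
    · rw [Ordinal.card_toZFSet, Cardinal.card_ord]; exact Order.lt_succ _
  refine ⟨c.ord.toZFSet, ZCard_ord c, hx, fun k hk => ?_⟩
  have := card_lt_of_mem_HSet (hx _ hk)
  rw [Ordinal.card_toZFSet, Ordinal.card_toZFSet, Cardinal.card_ord] at this
  rw [Ordinal.toZFSet_mem_toZFSet_iff, Cardinal.lt_ord]
  exact this

/-- the family of definable sets of valuations -/
noncomputable def defR (I M : ZFSet.{u}) (φ : SF) : ZFSet.{u} :=
  ZFSet.sep (fun v => SatIn ∅ (MS M) φ (extn v)) (ZFSet.powerset (ZFSet.prod I M))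

theorem mem_defR {I M v : ZFSet.{u}} (hv : cV I M v) (φ : SF) :
    v ∈ defR I M φ ↔ SatIn ∅ (MS M) φ (extn v) := by
  simp only [defR, ZFSet.mem_sep, ZFSet.mem_powerset]
  exact ⟨fun h => h.2, fun h => ⟨cV_subset hv, h⟩⟩

/-- the family of definable sets of valuations -/
noncomputable def famD (I M : ZFSet.{u}) : ZFSet.{u} :=
  ZFSet.sep (fun R => ∃ φ, R = defR I M φ) (ZFSet.powerset (ZFSet.powerset (ZFSet.prod I M)))

theorem mem_famD {I M R : ZFSet.{u}} : R ∈ famD I M ↔ ∃ φ, R = defR I M φ := by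
  simp only [famD, ZFSet.mem_sep, ZFSet.mem_powerset]
  refine ⟨fun h => h.2, fun h => ⟨?_, h⟩⟩
  obtain ⟨φ, rfl⟩ := h
  exact fun v hv => (ZFSet.mem_sep.1 hv).1

variable {I M : ZFSet.{u}}

theorem src_D1 (hI : ∀ i, i ∈ I ↔ ∃ n, i = num n) (S : Set ZFSet.{u}) :
    cD1 S M I (famD I M) := by
  have hI' : ∀ n, num n ∈ I := fun n => (hI _).2 ⟨n, rfl⟩
  refine ⟨?_, ?_, ?_, ?_⟩
  · intro i hi j hj
    obtain ⟨m, rfl⟩ := (hI _).1 hi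
    obtain ⟨n, rfl⟩ := (hI _).1 hj
    refine ⟨defR I M (.mem m n), mem_famD.2 ⟨_, rfl⟩, fun v _ hv => ?_⟩
    rw [mem_defR hv]
    simp only [extn_spec hI' hv, SatIn, Sat]
    constructor
    · intro h
      exact ⟨_, extn_mem hI' hv m, _, extn_mem hI' hv n, rfl, rfl, h⟩
    · rintro ⟨x, -, y, -, rfl, rfl, h⟩; exact h
  · intro i hi j hj
    obtain ⟨m, rfl⟩ := (hI _).1 hi
    obtain ⟨n, rfl⟩ := (hI _).1 hj
    refine ⟨defR I M (.eq m n), mem_famD.2 ⟨_, rfl⟩, fun v _ hv => ?_⟩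
    rw [mem_defR hv]
    simp only [extn_spec hI' hv, SatIn, Sat]
    constructor
    · intro h
      exact ⟨_, extn_mem hI' hv m, rfl, h⟩
    · rintro ⟨x, -, rfl, h⟩; exact h
  · intro R hR
    obtain ⟨φ, rfl⟩ := mem_famD.1 hR
    refine ⟨defR I M (.not φ), mem_famD.2 ⟨_, rfl⟩, fun v _ hv => ?_⟩
    rw [mem_defR hv, mem_defR hv]; rfl
  · intro R hR Q hQ
    obtain ⟨φ, rfl⟩ := mem_famD.1 hR
    obtain ⟨ψ, rfl⟩ := mem_famD.1 hQ
    refine ⟨defR I M (.and φ ψ), mem_famD.2 ⟨_, rfl⟩, fun v _ hv => ?_⟩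
    rw [mem_defR hv, mem_defR hv, mem_defR hv]; rfl

theorem src_D2 (hI : ∀ i, i ∈ I ↔ ∃ n, i = num n) {S : Set ZFSet.{u}}
    (hS : ∀ f, f ⊆ ZFSet.prod I M → f ∈ S) {κ b : ZFSet.{u}}
    (hE : ElemSub ∅ {x | x ∈ M ∧ ∃ α ∈ κ, ZFSet.pair α x ∈ b} (MS M)) :
    cD2 S κ M I b (famD I M) := by
  have hI' : ∀ n, num n ∈ I := fun n => (hI _).2 ⟨n, rfl⟩
  constructor
  · intro R hR i hi
    obtain ⟨φ, rfl⟩ := mem_famD.1 hR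
    obtain ⟨n, rfl⟩ := (hI _).1 hi
    refine ⟨defR I M (.ex n φ), mem_famD.2 ⟨_, rfl⟩, fun v _ hv => ?_⟩
    rw [mem_defR hv]
    refine (ex_clause hI' hS hv n (fun f => SatIn ∅ (MS M) φ f)).trans ?_
    refine exists_congr fun w => and_congr_right fun hwS => and_congr_right fun hw =>
      and_congr_right fun _ => (mem_defR hw φ).symm
  · intro R hR i hi v hvS hv hvX hex
    obtain ⟨φ, rfl⟩ := mem_famD.1 hR
    obtain ⟨n, rfl⟩ := (hI _).1 hi
    have hvX' : ∀ m, extn v m ∈ {x | x ∈ M ∧ ∃ α ∈ κ, ZFSet.pair α x ∈ b} := by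
      intro m
      obtain ⟨x, hx, α, hα, h1, h2⟩ := hvX _ (hI' m)
      rw [extn_spec hI' hv] at h1
      subst h1
      exact ⟨hx, α, hα, h2⟩
    have h1 : SatIn ∅ (MS M) (.ex n φ) (extn v) := by
      obtain ⟨w, hwS, hw, hu, hwR⟩ := hex
      exact (ex_clause hI' hS hv n (fun f => SatIn ∅ (MS M) φ f)).2
        ⟨w, hwS, hw, hu, (mem_defR hw φ).1 hwR⟩
    have h2 := (hE.2 (.ex n φ) _ hvX').2 h1
    obtain ⟨x, hx, h3⟩ := h2
    have h4 : SatIn ∅ (MS M) φ (Function.update (extn v) n x) := by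
      refine (hE.2 φ _ ?_).1 h3
      intro m
      by_cases hm : m = n
      · subst hm; simpa using hx
      · rw [Function.update_of_ne hm]; exact hvX' m
    obtain ⟨w, w1, w2, w3, w4⟩ := exists_upd hI' hv n hx.1
    obtain ⟨hxM, α, hα, hb⟩ := hx
    refine ⟨w, hS w w1, w2, w3, (mem_defR w2 φ).2 (w4 ▸ h4), x, hxM, α, hα, ?_, hb⟩
    rw [extn_spec hI' w2, w4]; simp

theorem source {κ θ z : ZFSet.{u}} {k : Ordinal.{u}} (hκk : κ = k.toZFSet) (hk : PClosed k)
    (hθ : ZCard θ) (hκθ : κ ∈ θ)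
    (hM' : ∀ α < k, hull κ z (HSet θ) α ∈ HSet θ) :
    ∃ A ν : ZFSet.{u}, A ⊆ κ ∧ ZCard ν ∧ κ ∈ ν ∧ A ∈ HSet ν ∧ κ ∈ HSet ν ∧ cQ (HSet ν) A κ ∧
      ∀ a < k, ∀ b < k, ((gp a b).toZFSet ∈ A ↔ hull κ z (HSet θ) a ∈ hull κ z (HSet θ) b) := by
  have tm : ∀ {a : Ordinal.{u}}, a < k → a.toZFSet ∈ κ := by
    rw [hκk]
    exact fun h => Ordinal.toZFSet_mem_toZFSet_iff.2 h
  have tm' : ∀ {x : ZFSet.{u}}, x ∈ κ → ∃ a < k, a.toZFSet = x := by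
    rw [hκk]
    exact fun h => Ordinal.mem_toZFSet_iff.1 h
  have ti : ∀ {a b : Ordinal.{u}}, a.toZFSet = b.toZFSet ↔ a = b :=
    fun {a b} => Ordinal.toZFSet_injective.eq_iff
  have hk1 : 1 < k := Ordinal.one_lt_omega0.trans_le hk.1
  have hk0 := hk.zero_lt
  set h := hull κ z (HSet θ) with hh
  obtain ⟨M, hM⟩ := HSet_set θ
  let A := ZFSet.sep (fun γ => ∃ a < k, ∃ b < k, γ = (gp a b).toZFSet ∧ h a ∈ h b) κ
  let I : ZFSet.{u} := ZFSet.range (fun n : ℕ => (num n : ZFSet.{u}))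
  let p := ZFSet.sep (fun q => ∃ a b : Ordinal.{u}, q = ZFSet.pair (ZFSet.pair a.toZFSet b.toZFSet) (gp a b).toZFSet)
    (ZFSet.prod (ZFSet.prod κ κ) κ)
  let b := ZFSet.sep (fun q => ∃ a : Ordinal.{u}, q = ZFSet.pair a.toZFSet (h a)) (ZFSet.prod κ M)
  let D := famD I M
  obtain ⟨ν, hν, hx, hkν⟩ := exists_big {A, κ, θ, M, I, D, p, b}
  have hA : ∀ a < k, ∀ b < k, ((gp a b).toZFSet ∈ A ↔ h a ∈ h b) := by
    intro a ha b hb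
    simp only [A, ZFSet.mem_sep]
    constructor
    · rintro ⟨-, a', -, b', -, he, hm⟩
      rw [ti] at he
      have := gpair_inj he
      rw [Prod.ext_iff] at this
      obtain ⟨h1, h2⟩ := this
      simp only at h1 h2
      rwa [h1, h2]
    · intro hm
      exact ⟨tm (hk.2 a ha b hb), a, ha, b, hb, rfl, hm⟩
  have hIi : ∀ i, i ∈ I ↔ ∃ n, i = num n := by
    intro i
    simp only [I, ZFSet.mem_range, Set.mem_range, eq_comm]
  have hIn : ∀ n, num n ∈ I := fun n => (hIi _).2 ⟨n, rfl⟩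
  have hpi : ∀ a < k, ∀ b < k, ∀ c, P3 p a.toZFSet b.toZFSet c ↔ c = (gp a b).toZFSet := by
    intro a ha b hb c
    simp only [P3, p, ZFSet.mem_sep, ZFSet.pair_mem_prod, ZFSet.pair_inj, ti]
    constructor
    · rintro ⟨-, a', b', ⟨rfl, rfl⟩, rfl⟩; rfl
    · rintro rfl
      exact ⟨⟨⟨tm ha, tm hb⟩, tm (hk.2 a ha b hb)⟩, a, b, ⟨rfl, rfl⟩, rfl⟩
  have hhM : ∀ a < k, h a ∈ M := fun a ha => (hM _).2 (hM' a ha)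
  have hbi : ∀ a < k, ∀ x, ZFSet.pair a.toZFSet x ∈ b ↔ x = h a := by
    intro a ha x
    simp only [b, ZFSet.mem_sep, ZFSet.pair_mem_prod, ZFSet.pair_inj, ti]
    constructor
    · rintro ⟨-, a', rfl, rfl⟩; rfl
    · rintro rfl
      exact ⟨⟨tm ha, hhM a ha⟩, a, rfl, rfl⟩
  have hInu : I ∈ HSet ν := hx _ (by simp)
  have hMnu : M ∈ HSet ν := hx _ (by simp)
  have hθnu : θ ∈ HSet ν := hx _ (by simp)
  have hνc : ℵ₀ ≤ ν.card := (card_of_num hIn).trans (card_lt_of_mem_HSet hInu).le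
  have hS : ∀ f, f ⊆ ZFSet.prod I M → f ∈ HSet ν := fun f hf => HSet_prod hνc hInu hMnu hf
  have hMS : MS M = HSet θ := Set.ext hM
  refine ⟨A, ν, fun y hy => (ZFSet.mem_sep.1 hy).1, hν, ?_, hx _ (by simp), hx _ (by simp), ?_, hA⟩
  · rw [hκk]; apply hkν; rw [← hκk]; simp
  refine ⟨θ, hθnu, M, hMnu, I, hInu, D, hx _ (by simp), p, hx _ (by simp), b, hx _ (by simp),
    (cCard_iff hνc hθnu).2 hθ, hκθ, (cH_iff hνc hθnu hMnu).2 hM, ?_, ?_, ?_, ?_, ?_,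
    src_D1 hIi _, src_D2 hIi hS ?_⟩
  · refine ⟨⟨∅, ?_, (cEmp_iff _).2 rfl⟩, fun i hi => ?_⟩
    · rw [← num_zero]; exact hIn 0
    · obtain ⟨n, rfl⟩ := (hIi _).1 hi
      exact ⟨num (n+1), hIn _, by rw [cSucc_iff, num_succ]⟩
  · refine ⟨⟨∅, ?_, (cEmp_iff _).2 rfl⟩, fun i hi => ?_⟩
    · rw [← Ordinal.toZFSet_zero]; exact tm hk0
    · obtain ⟨a, ha, rfl⟩ := tm' hi
      refine ⟨(a+1).toZFSet, tm ?_, by rw [cSucc_iff, Ordinal.toZFSet_add_one]⟩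
      exact (Order.add_one_le_of_lt (snd_lt_gp a zero_lt_one)).trans_lt (hk.2 1 hk1 a ha)
  · refine ⟨fun α hα β hβ => ?_, fun α hα β hβ γ hγ hp δ hδ => ?_⟩
    · obtain ⟨a, ha, rfl⟩ := tm' hα
      obtain ⟨b, hb, rfl⟩ := tm' hβ
      exact ⟨_, tm (hk.2 a ha b hb), (hpi a ha b hb _).2 rfl⟩
    · obtain ⟨a, ha, rfl⟩ := tm' hα
      obtain ⟨b, hb, rfl⟩ := tm' hβ
      rw [hpi a ha b hb] at hp
      subst hp
      obtain ⟨d, hd, rfl⟩ := tm' hδ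
      rw [Ordinal.toZFSet_mem_toZFSet_iff, gp, lt_gpair]
      constructor
      · rintro ⟨x, hxy, rfl⟩
        obtain ⟨h1, h2⟩ := GO_bd hxy ha hb
        exact ⟨_, tm h1, _, tm h2, (cGO_iff x.1 x.2 a b).2 hxy, (hpi _ h1 _ h2 _).2 rfl⟩
      · rintro ⟨α', hα', β', hβ', hg, hp'⟩
        obtain ⟨a', ha', rfl⟩ := tm' hα'
        obtain ⟨b', hb', rfl⟩ := tm' hβ'
        rw [hpi a' ha' b' hb', ti] at hp'
        exact ⟨(a', b'), (cGO_iff _ _ _ _).1 hg, hp'.symm⟩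
  · refine ⟨fun α hα => ?_, fun α hα x _ y _ h1 h2 => ?_, fun o _ ho α hα γ hγ hp => ?_,
      fun o _ e _ ho he γ hγ hp => ?_⟩
    · obtain ⟨a, ha, rfl⟩ := tm' hα
      exact ⟨h a, hhM a ha, (hbi a ha _).2 rfl⟩
    · obtain ⟨a, ha, rfl⟩ := tm' hα
      rw [hbi a ha] at h1 h2
      rw [h1, h2]
    · obtain ⟨a, ha, rfl⟩ := tm' hα
      rw [cEmp_iff, ← Ordinal.toZFSet_zero] at ho
      subst ho
      rw [hpi 0 hk0 a ha] at hp
      subst hp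
      rw [hbi _ (hk.2 0 hk0 a ha), hh, hull_zero]
    · rw [cEmp_iff, ← Ordinal.toZFSet_zero] at ho
      subst ho
      rw [cSucc_iff, ← Ordinal.toZFSet_add_one, zero_add] at he
      subst he
      rw [hpi 1 hk1 0 hk0] at hp
      subst hp
      rw [hbi _ (hk.2 1 hk1 0 hk0), hh, hull_one]
  · intro α hα β hβ γ hγ hp
    obtain ⟨a, ha, rfl⟩ := tm' hα
    obtain ⟨c, hc, rfl⟩ := tm' hβ
    rw [hpi a ha c hc] at hp
    subst hp
    rw [hA a ha c hc]
    simp only [hbi a ha, hbi c hc]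
    constructor
    · intro hm
      exact ⟨_, hhM a ha, _, hhM c hc, rfl, rfl, hm⟩
    · rintro ⟨x, -, y, -, rfl, rfl, hm⟩; exact hm
  · rw [hMS]
    convert hull_elem (κ := κ) (z := z) (M := HSet θ) hk hM' using 1
    ext x
    constructor
    · rintro ⟨-, α, hα, hb⟩
      obtain ⟨a, ha, rfl⟩ := tm' hα
      exact ⟨a, ha, ((hbi a ha x).1 hb).symm⟩
    · rintro ⟨a, ha, rfl⟩
      exact ⟨hhM a ha, _, tm ha, (hbi a ha _).2 rfl⟩

end sourceSide

/-- A cardinal `κ` is weakly shrewd if and only if for all cardinals `θ > κ`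
and all `z ∈ H(θ)`, there are cardinals `κ̄ < θ̄`, an elementary submodel `X`
of `H(θ̄)` and an elementary embedding `j : X → H(θ)` with `κ̄ + 1 ⊆ X`,
`j ↾ κ̄ = id`, `j(κ̄) = κ > κ̄` and `z ∈ ran(j)`. -/
theorem weaklyShrewd_iff_embedding (κ : ZFSet.{u}) (hκ : InfCard κ) :
    WeaklyShrewd κ ↔
      ∀ θ : ZFSet.{u}, ZCard θ → κ ∈ θ → ∀ z ∈ HSet θ,
        ∃ (κ' θ' : ZFSet.{u}) (X : Set ZFSet.{u}) (j : ZFSet.{u} → ZFSet.{u}),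
          ZCard κ' ∧ ZCard θ' ∧ κ' ∈ θ' ∧ κ' ∈ κ ∧
          ElemSub ∅ X (HSet θ') ∧ ElemEmbOn ∅ X (HSet θ) j ∧
          (∀ β ∈ κ', β ∈ X) ∧ κ' ∈ X ∧
          (∀ β ∈ κ', j β = β) ∧ j κ' = κ ∧ ∃ x ∈ X, j x = z := by
  constructor
  · intro hW θ hθ hκθ z hz
    obtain ⟨k, hk, hkc⟩ := hκ.1.exists_ord
    have hω := hκ.omega_le hk
    have hPC := PClosed_card hkc hω
    have hκH : κ ∈ HSet θ := mem_HSet_of_trans hκ.1.1.1 (((ZCard_iff _).1 hθ).2 _ hκθ)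
    have hoH : ∀ α < k, α.toZFSet ∈ HSet θ := fun α hα =>
      STr_HSet θ _ hκH _ (by rw [hk]; exact Ordinal.toZFSet_mem_toZFSet_iff.2 hα)
    have h0 : (∅ : ZFSet.{u}) ∈ HSet θ := by
      have := hoH 0 hPC.zero_lt
      rwa [Ordinal.toZFSet_zero] at this
    have hM := fun α hα => hull_mem h0 hκH hz hoH α hα
    obtain ⟨A, ν, hAκ, hν, hκν, hAH, hκH', hQ, hA⟩ := source hk hPC hθ hκθ hM
    obtain ⟨φ, hφ, hφQ⟩ := cQ_formula.{u}
    obtain ⟨κ', θ'', hκ', hθ'', h1, h2, h3⟩ := hW.2 φ ν A hφ hν hκν hAκ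
      ((hφQ _ (STr_HSet ν) A hAH κ hκH').2 hQ)
    have hκ'H : κ' ∈ HSet θ'' := mem_HSet_of_trans hκ'.1.1 (((ZCard_iff _).1 hθ'').2 _ h1)
    have hA'H : A ∩ κ' ∈ HSet θ'' := HSet_subset hκ'H (fun y hy => (ZFSet.mem_inter.1 hy).2)
    rw [hφQ _ (STr_HSet θ'') _ hA'H _ hκ'H] at h3
    obtain ⟨k', rfl, -⟩ := hκ'.exists_ord
    have hkk : k' < k := by
      rw [hk] at h2
      exact Ordinal.toZFSet_mem_toZFSet_iff.1 h2
    obtain ⟨θ', X, j, c1, c2, c3, c4, c5, c6, c7, c8, c9⟩ :=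
      reflect (κ := κ) (z := z) (θ := θ) hκ'H h3 (fun α hα => hM α (hα.trans hkk))
        (fun a ha b hb hab => by
          rw [← hA a (ha.trans hkk) b (hb.trans hkk), ZFSet.mem_inter,
            Ordinal.toZFSet_mem_toZFSet_iff, and_iff_left hab])
    exact ⟨_, θ', X, j, hκ', c1, c2, h2, c3, c4, c5, c6, c7, c8, c9⟩
  · intro H
    refine ⟨hκ, fun φ θ A hφ hθ hκθ hAκ hsat => ?_⟩
    have hκH : κ ∈ HSet θ := mem_HSet_of_trans hκ.1.1.1 (((ZCard_iff _).1 hθ).2 _ hκθ)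
    obtain ⟨κ', θ', X, j, h1, h2, h3, h4, hX, hj, h5, h6, h7, h8, x, hx, hxA⟩ :=
      H θ hθ hκθ A (HSet_subset hκH hAκ)
    have hmem : ∀ a ∈ X, ∀ b ∈ X, a ∈ b ↔ j a ∈ j b := by
      intro a ha b hb
      have := hj.2 (.mem 0 1) (fun i => if i = 0 then a else b) (by
        intro i; split_ifs <;> assumption)
      simpa [SatIn, Sat] using this
    have hv : ∀ i : ℕ, (fun i : ℕ => if i = 0 then x else κ') i ∈ X := by
      intro i; dsimp only; split_ifs <;> assumption
    have hxκ : ∀ y ∈ x, y ∈ κ' := by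
      intro y hy
      by_contra hn
      have e1 : SatIn ∅ (HSet θ') (.ex 2 (.and (.mem 2 0) (.not (.mem 2 1))))
          (fun i : ℕ => if i = 0 then x else κ') :=
        ⟨y, STr_HSet θ' _ (hX.1 hx) _ hy, by simpa [Sat] using ⟨hy, hn⟩⟩
      rw [← hX.2 _ _ hv, hj.2 _ _ hv] at e1
      obtain ⟨w, -, hw⟩ := e1
      simp [Sat] at hw
      rw [hxA, h8] at hw
      exact hw.2 (hAκ hw.1)
    have hxe : x = A ∩ κ' := by
      ext y
      rw [ZFSet.mem_inter]
      constructor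
      · intro hy
        have hyκ := hxκ y hy
        have := (hmem y (h5 y hyκ) x hx).1 hy
        rw [h7 y hyκ, hxA] at this
        exact ⟨this, hyκ⟩
      · rintro ⟨hy, hyκ⟩
        rw [hmem y (h5 y hyκ) x hx, h7 y hyκ, hxA]
        exact hy
    refine ⟨κ', θ', h1, h2, h3, h4, ?_⟩
    rw [← hxe]
    have e1 : SatIn ∅ (HSet θ') φ (val2 x κ') ↔
        SatIn ∅ (HSet θ') φ (fun i : ℕ => if i = 0 then x else κ') := by
      apply sat_congr
      intro i hi
      rcases hφ hi with rfl | rfl <;> simp [val2]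
    rw [e1, ← hX.2 _ _ hv, hj.2 _ _ hv]
    refine (sat_congr _ _ _ _ _ ?_).1 hsat
    intro i hi
    rcases hφ hi with rfl | rfl
    · simp [val2, hxA]
    · simp [val2, h8]
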